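/- arXiv:1703.01152 — 3 statements merged into one kernel-verified Lean document; each statement's English description precedes it below -/
import Mathlib

section
/- Let D be a finite-dimensional division algebra over Q and R an order in D. Then the unit group Rˣ is finite if and only if the real algebra R ⊗_Q D obtained by extension of scalars to R is a division ring (equivalently, isomorphic to R, C, or the quaternions H by Frobenius's theorem). -/
open scoped TensorProduct

/-- An order in a finite-dimensional `ℚ`-algebra. -/
def IsOrder {A : Type*} [Ring A] [Algebra ℚ A] (R : Subring A) : Prop :=
  Submodule.span ℚ (R : Set A) = ⊤ ∧ (AddSubgroup.toIntSubmodule R.toAddSubgroup).FG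

/-- `x` is a unit of the subring `R`. -/
def IsUnitOf {A : Type*} [Ring A] (R : Subring A) (x : A) : Prop :=
  x ∈ R ∧ ∃ y ∈ R, x * y = 1 ∧ y * x = 1

/-- An order is the `ℤ`-span of some `ℚ`-basis of the ambient algebra. -/
theorem IsOrder.exists_basis {A : Type*} [Ring A] [Algebra ℚ A] {R : Subring A}
    (hR : IsOrder R) : ∃ (n : ℕ) (b : Module.Basis (Fin n) ℚ A),
      AddSubgroup.toIntSubmodule R.toAddSubgroup = Submodule.span ℤ (Set.range b) := by
  obtain ⟨hspan, hfg⟩ := hR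
  set P := AddSubgroup.toIntSubmodule R.toAddSubgroup with hP
  have : Module.Finite ℤ P := Module.Finite.iff_fg.mpr hfg
  have : IsAddTorsionFree A := IsAddTorsionFree.of_module_rat A
  let c := Module.finBasis ℤ P
  have hspanZ : Submodule.span ℤ (Set.range (P.subtype ∘ c)) = P := by
    rw [Set.range_comp, ← Submodule.map_span, c.span_eq, Submodule.map_top, Submodule.range_subtype]
  have hli : LinearIndependent ℤ (P.subtype ∘ c) :=
    c.linearIndependent.map' P.subtype (Submodule.ker_subtype P)
  have hliQ : LinearIndependent ℚ (P.subtype ∘ c) :=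
    (LinearIndependent.iff_fractionRing ℤ ℚ).mp hli
  have hsp : ⊤ ≤ Submodule.span ℚ (Set.range (P.subtype ∘ c)) := by
    rw [← hspan, Submodule.span_le]
    intro x hx
    have hx' : x ∈ Submodule.span ℤ (Set.range (P.subtype ∘ c)) := by
      rw [hspanZ]; exact hx
    exact Submodule.span_subset_span ℤ ℚ _ hx'
  refine ⟨_, Module.Basis.mk hliQ hsp, ?_⟩
  rw [Module.Basis.coe_mk, hspanZ]

section RealAlgebra

variable {A : Type*} [Ring A] [Algebra ℝ A] {n : ℕ} (b : Module.Basis (Fin n) ℝ A)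

include b in
/-- In a finite-dimensional algebra, elements of nonzero norm are units. -/
theorem Algebra.isUnit_of_norm_ne_zero {x : A} (hx : Algebra.norm ℝ x ≠ 0) : IsUnit x := by
  have : FiniteDimensional ℝ A := b.finiteDimensional_of_finite
  have key : ∀ z : A, Algebra.norm ℝ z ≠ 0 → ∃ w, z * w = 1 := by
    intro z hz
    rw [Algebra.norm_apply] at hz
    obtain ⟨w, hw⟩ := (LinearMap.equivOfDetNeZero (Algebra.lmul ℝ A z) hz).surjective 1
    exact ⟨w, hw⟩
  obtain ⟨y, hy⟩ := key x hx
  have hy0 : Algebra.norm ℝ y ≠ 0 := by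
    intro h0
    have := congrArg (Algebra.norm ℝ) hy
    simp [h0] at this
  obtain ⟨z, hz⟩ := key y hy0
  exact ⟨⟨x, y, hy, left_inv_eq_right_inv hy hz ▸ hz⟩, rfl⟩

include b in
theorem Algebra.norm_smul_basis (r : ℝ) (x : A) :
    Algebra.norm ℝ (r • x) = r ^ n * Algebra.norm ℝ x := by
  rw [Algebra.norm_eq_matrix_det b, Algebra.norm_eq_matrix_det b, map_smul, Matrix.det_smul,
    Fintype.card_fin]

theorem Algebra.continuous_norm_equivFun_symm :
    Continuous fun v => Algebra.norm ℝ (b.equivFun.symm v) := by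
  simp_rw [Algebra.norm_eq_matrix_det b]
  have : Continuous ((Algebra.leftMulMatrix b).toLinearMap ∘ₗ b.equivFun.symm.toLinearMap) :=
    LinearMap.continuous_of_finiteDimensional _
  exact this.matrix_det

/-- A bounded region contains finitely many points of the lattice spanned by a basis. -/
theorem Module.Basis.finite_span_int_inter_norm_le (K : ℝ) :
    {x : A | x ∈ Submodule.span ℤ (Set.range b) ∧ ‖b.equivFun x‖ ≤ K}.Finite := by
  have hf : (Set.Icc (fun _ => -⌈K⌉) (fun _ => ⌈K⌉) : Set (Fin n → ℤ)).Finite := Set.finite_Icc _ _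
  refine (hf.image fun k => b.equivFun.symm fun i => (k i : ℝ)).subset ?_
  rintro x ⟨hx, hK⟩
  rw [b.mem_span_iff_repr_mem ℤ] at hx
  choose k hk using hx
  have hk' : ∀ i, (k i : ℝ) = b.equivFun x i := hk
  have hb : ∀ i, |(k i : ℝ)| ≤ K := fun i => by
    rw [hk']; exact (norm_le_pi_norm (b.equivFun x) i).trans hK
  refine ⟨k, ⟨fun i => ?_, fun i => ?_⟩, ?_⟩
  · have := (abs_le.mp (hb i)).1
    have h2 := Int.le_ceil K
    exact_mod_cast (by linarith : -(⌈K⌉ : ℝ) ≤ k i)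
  · exact_mod_cast ((abs_le.mp (hb i)).2.trans (Int.le_ceil K) : (k i : ℝ) ≤ ⌈K⌉)
  · simp only [hk', LinearEquiv.symm_apply_apply]

variable {L : Subring A}
  (hL : AddSubgroup.toIntSubmodule L.toAddSubgroup = Submodule.span ℤ (Set.range b))

include hL

theorem Subring.exists_int_leftMulMatrix {x : A} (hx : x ∈ L) :
    ∃ M : Matrix (Fin n) (Fin n) ℤ,
      Algebra.leftMulMatrix b x = (Int.castRingHom ℝ).mapMatrix M := by
  have h : ∀ i j, ∃ k : ℤ, (k : ℝ) = Algebra.leftMulMatrix b x i j := by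
    intro i j
    have hj : b j ∈ L := by
      have : b j ∈ AddSubgroup.toIntSubmodule L.toAddSubgroup := by
        rw [hL]; exact Submodule.subset_span ⟨j, rfl⟩
      exact this
    have hm : x * b j ∈ Submodule.span ℤ (Set.range b) := by
      rw [← hL]; exact L.mul_mem hx hj
    rw [Algebra.leftMulMatrix_eq_repr_mul]
    exact (b.mem_span_iff_repr_mem ℤ _).mp hm i
  choose k hk using h
  exact ⟨Matrix.of k, by ext i j; simp [hk]⟩

theorem Subring.exists_int_norm {x : A} (hx : x ∈ L) : ∃ k : ℤ, Algebra.norm ℝ x = k := by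
  obtain ⟨M, hM⟩ := Subring.exists_int_leftMulMatrix b hL hx
  refine ⟨M.det, ?_⟩
  rw [Algebra.norm_eq_matrix_det b, hM, ← RingHom.map_det]; rfl

/-- If `x * y = 1` with `x` in the lattice, then `N(x) y` is in it. -/
theorem Subring.norm_smul_inverse_mem {x y : A} (hx : x ∈ L) (hxy : x * y = 1) :
    Algebra.norm ℝ x • y ∈ L := by
  obtain ⟨M, hM⟩ := Subring.exists_int_leftMulMatrix b hL hx
  have h1 : (1 : A) ∈ Submodule.span ℤ (Set.range b) := by rw [← hL]; exact L.one_mem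
  rw [b.mem_span_iff_repr_mem ℤ] at h1
  choose k hk using h1
  suffices h : Algebra.norm ℝ x • y ∈ AddSubgroup.toIntSubmodule L.toAddSubgroup from h
  rw [hL, b.mem_span_iff_repr_mem ℤ]
  intro i
  have h2 := Algebra.leftMulMatrix_mulVec_repr b x y
  rw [hxy] at h2
  have h3 := congrArg (fun v => ((Algebra.leftMulMatrix b x).adjugate).mulVec v) h2
  simp only [Matrix.mulVec_mulVec, Matrix.adjugate_mul, Matrix.smul_mulVec, Matrix.one_mulVec,
    ← Algebra.norm_eq_matrix_det b] at h3
  refine ⟨(M.adjugate.mulVec k) i, ?_⟩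
  rw [map_smul, Finsupp.smul_apply, ← Pi.smul_apply, h3, hM, ← RingHom.map_adjugate]
  have hk' : ⇑(b.repr 1) = (Int.castRingHom ℝ) ∘ k := by ext i; exact (hk i).symm
  rw [hk']
  exact RingHom.map_mulVec (Int.castRingHom ℝ) _ _ _

theorem IsUnitOf.abs_norm_eq_one {x : A} (hx : IsUnitOf L x) : |Algebra.norm ℝ x| = 1 := by
  obtain ⟨hxL, y, hyL, hxy, -⟩ := hx
  obtain ⟨k, hk⟩ := Subring.exists_int_norm b hL hxL
  obtain ⟨l, hl⟩ := Subring.exists_int_norm b hL hyL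
  have h := congrArg (Algebra.norm ℝ) hxy
  rw [map_mul, map_one, hk, hl] at h
  have h' : k * l = 1 := by exact_mod_cast h
  rw [hk]
  exact_mod_cast Int.isUnit_iff_abs_eq.mp (IsUnit.of_mul_eq_one _ h')

/-- If `A` is a division algebra, the norm is bounded below on the unit sphere, so the elements of
norm `± 1` are bounded and the lattice `L` contains finitely many of them. -/
theorem finite_isUnitOf_of_forall_isUnit [Nontrivial A] (h : ∀ t : A, t ≠ 0 → IsUnit t) :
    {x : A | IsUnitOf L x}.Finite := by
  have hn : n ≠ 0 := by
    rintro rfl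
    exact not_subsingleton A b.equivFun.injective.subsingleton
  have hne : ∀ t : A, t ≠ 0 → Algebra.norm ℝ t ≠ 0 := fun t ht =>
    ((h t ht).map (Algebra.norm ℝ)).ne_zero
  have : NeZero n := ⟨hn⟩
  obtain ⟨v₀, hv₀, hmin⟩ := (isCompact_sphere (0 : Fin n → ℝ) 1).exists_isMinOn
    (NormedSpace.sphere_nonempty.mpr zero_le_one)
    (Algebra.continuous_norm_equivFun_symm b).abs.continuousOn
  set c := |Algebra.norm ℝ (b.equivFun.symm v₀)| with hc
  have hc0 : 0 < c := abs_pos.mpr (hne _ (by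
    rw [Ne, LinearEquiv.map_eq_zero_iff]
    rintro rfl
    simp at hv₀))
  refine (b.finite_span_int_inter_norm_le (max 1 (1 / c))).subset ?_
  intro x hx
  refine ⟨by rw [← hL]; exact hx.1, ?_⟩
  have hN := IsUnitOf.abs_norm_eq_one b hL hx
  by_contra! hlt
  set r := ‖b.equivFun x‖ with hr
  have hr1 : 1 < r := (le_max_left _ _).trans_lt hlt
  have hr2 : 1 / c < r := (le_max_right _ _).trans_lt hlt
  have hmem : r⁻¹ • b.equivFun x ∈ Metric.sphere (0 : Fin n → ℝ) 1 := by
    rw [mem_sphere_zero_iff_norm, norm_smul, norm_inv, Real.norm_of_nonneg (by linarith), ← hr,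
      inv_mul_cancel₀ (by linarith)]
  have h1 : c ≤ |Algebra.norm ℝ (b.equivFun.symm (r⁻¹ • b.equivFun x))| := hmin hmem
  rw [map_smul, LinearEquiv.symm_apply_apply, Algebra.norm_smul_basis b r⁻¹ x, abs_mul, hN, mul_one,
    abs_of_pos (by positivity), inv_pow] at h1
  have h2 : r ≤ r ^ n := le_self_pow₀ hr1.le hn
  have h3 : (r ^ n)⁻¹ ≤ r⁻¹ := inv_anti₀ (by linarith) h2
  have h4 : r⁻¹ < c := by
    rw [inv_lt_comm₀ (by linarith) hc0, ← one_div]; exact hr2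
  linarith


/-- If `Lˣ` is finite, then `L` has finitely many elements of given nonzero norm `m`: two such
elements congruent modulo `m L` differ by a unit of `L`. -/
theorem finite_norm_eq (hfin : {x : A | IsUnitOf L x}.Finite) {m : ℤ} (hm : m ≠ 0) :
    {x : A | x ∈ L ∧ Algebra.norm ℝ x = m}.Finite := by
  have : NeZero m.natAbs := ⟨Int.natAbs_ne_zero.mpr hm⟩
  have hm' : (m : ℝ) ≠ 0 := Int.cast_ne_zero.mpr hm
  refine Set.Finite.of_finite_fibers
    (fun x i => ((Int.floor (b.repr x i) : ℤ) : ZMod m.natAbs)) (Set.toFinite _) ?_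
  rintro _ ⟨x, ⟨hxL, hxm⟩, rfl⟩
  obtain ⟨u, rfl⟩ := Algebra.isUnit_of_norm_ne_zero b (x := x) (by rw [hxm]; exact hm')
  refine ((hfin.image fun z : A => (u : A) * z)).subset ?_
  rintro y ⟨⟨hyL, hym⟩, hy⟩
  obtain ⟨v, rfl⟩ := Algebra.isUnit_of_norm_ne_zero b (x := y) (by rw [hym]; exact hm')
  have hdiv : ∃ z ∈ L, (v : A) - u = m • z := by
    have hvu : (v : A) ∈ Submodule.span ℤ (Set.range b) := by rw [← hL]; exact hyL
    have huu : (u : A) ∈ Submodule.span ℤ (Set.range b) := by rw [← hL]; exact hxL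
    rw [b.mem_span_iff_repr_mem ℤ] at hvu huu
    choose k hk using hvu
    choose l hl using huu
    have hkl : ∀ i, ∃ q : ℤ, k i - l i = m * q := by
      intro i
      have h1 := congrFun hy i
      simp only [← hk, ← hl, algebraMap_int_eq, eq_intCast, Int.floor_intCast] at h1
      rw [ZMod.intCast_eq_intCast_iff, Int.modEq_comm, Int.modEq_iff_dvd, Int.natCast_natAbs,
        abs_dvd] at h1
      exact h1
    choose q hq using hkl
    refine ⟨b.equivFun.symm fun i => (q i : ℝ), ?_, ?_⟩
    · suffices h : b.equivFun.symm (fun i => (q i : ℝ)) ∈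
          AddSubgroup.toIntSubmodule L.toAddSubgroup from h
      rw [hL, b.mem_span_iff_repr_mem ℤ]
      intro i
      refine ⟨q i, ?_⟩
      rw [← b.equivFun_apply, LinearEquiv.apply_symm_apply]
      rfl
    · apply b.equivFun.injective
      ext i
      rw [map_sub, map_zsmul, LinearEquiv.apply_symm_apply]
      simp only [Pi.sub_apply, Pi.smul_apply, b.equivFun_apply, ← hk, ← hl]
      simp only [algebraMap_int_eq, eq_intCast, zsmul_eq_mul]
      exact_mod_cast hq i
  obtain ⟨z, hz, hvz⟩ := hdiv
  have hu := Subring.norm_smul_inverse_mem b hL hxL u.mul_inv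
  have hv := Subring.norm_smul_inverse_mem b hL hyL v.mul_inv
  rw [hxm] at hu
  rw [hym] at hv
  refine ⟨↑u⁻¹ * ↑v, ⟨?_, ↑v⁻¹ * ↑u, ?_, ?_, ?_⟩, ?_⟩
  · have : (↑u⁻¹ * ↑v : A) = 1 + ((m : ℝ) • (↑u⁻¹ : A)) * z := by
      have hv' : (v : A) = u + m • z := by rw [← hvz]; abel
      rw [hv', mul_add, u.inv_mul, mul_smul_comm, smul_mul_assoc, Int.cast_smul_eq_zsmul]
    rw [this]
    exact L.add_mem L.one_mem (L.mul_mem hu hz)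
  · have : (↑v⁻¹ * ↑u : A) = 1 - ((m : ℝ) • (↑v⁻¹ : A)) * z := by
      have hv' : (u : A) = v - m • z := by rw [← hvz]; abel
      rw [hv', mul_sub, v.inv_mul, mul_smul_comm, smul_mul_assoc, Int.cast_smul_eq_zsmul]
    rw [this]
    exact L.sub_mem L.one_mem (L.mul_mem hv hz)
  · simp [mul_assoc]
  · simp [mul_assoc]
  · simp

theorem finite_abs_norm_le (hfin : {x : A | IsUnitOf L x}.Finite) (K : ℝ) :
    {x : A | x ∈ L ∧ Algebra.norm ℝ x ≠ 0 ∧ |Algebra.norm ℝ x| ≤ K}.Finite := by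
  have h : (Set.Icc (-⌈K⌉) ⌈K⌉ \ {0}).Finite := (Set.finite_Icc _ _).subset Set.sdiff_subset
  refine (h.biUnion fun m hm => finite_norm_eq b hL hfin (m := m) hm.2).subset ?_
  rintro x ⟨hxL, hx0, hxK⟩
  obtain ⟨k, hk⟩ := Subring.exists_int_norm b hL hxL
  rw [hk] at hx0 hxK
  have h1 : |k| ≤ ⌈K⌉ := by
    have := hxK.trans (Int.le_ceil K)
    exact_mod_cast this
  exact Set.mem_biUnion (x := k) ⟨abs_le.mp h1, by simpa using hx0⟩ ⟨hxL, hk⟩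

open MeasureTheory in
/-- Minkowski's theorem for the lattice `a L`, where `a` has norm `± 1`. -/
theorem exists_ne_zero_norm_mul_le (hn : n ≠ 0) {a : A} (ha : |Algebra.norm ℝ a| = 1) :
    ∃ r ∈ L, r ≠ 0 ∧ ‖b.equivFun (a * r)‖ ≤ 2 := by
  set f := Matrix.toLin' (Algebra.leftMulMatrix b a) with hf
  have hdet : LinearMap.det f = Algebra.norm ℝ a := by
    rw [hf, LinearMap.det_toLin', Algebra.norm_eq_matrix_det b]
  have hdet0 : LinearMap.det f ≠ 0 := by
    rw [hdet, ← abs_pos, ha]; exact one_pos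
  have hfund := ZSpan.isAddFundamentalDomain (Pi.basisFun ℝ (Fin n)) volume
  have : Countable (Submodule.span ℤ (Set.range (Pi.basisFun ℝ (Fin n)))).toAddSubgroup :=
    inferInstanceAs (Countable (Submodule.span ℤ (Set.range (Pi.basisFun ℝ (Fin n)))))
  obtain ⟨⟨v, hv⟩, hv0, hvs⟩ := exists_ne_zero_mem_lattice_of_measure_mul_two_pow_lt_measure
    (L := (Submodule.span ℤ (Set.range (Pi.basisFun ℝ (Fin n)))).toAddSubgroup)
    (s := f ⁻¹' Metric.closedBall 0 2) hfund (by simp)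
    ((convex_closedBall 0 2).linear_preimage f) (by
      rw [Measure.addHaar_preimage_linearMap volume hdet0, abs_inv, hdet, ha,
        Real.volume_pi_closedBall _ zero_le_two, ZSpan.fundamentalDomain_pi_basisFun,
        Real.volume_pi_Ico]
      simp only [sub_zero, ENNReal.ofReal_one, Finset.prod_const_one, one_mul, inv_one,
        Module.finrank_fin_fun, Fintype.card_fin]
      rw [← ENNReal.ofReal_ofNat 2, ← ENNReal.ofReal_pow zero_le_two]
      refine (ENNReal.ofReal_lt_ofReal_iff (by positivity)).mpr ?_
      exact pow_lt_pow_left₀ (by norm_num) zero_le_two hn)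
  have hv' : v ∈ Submodule.span ℤ (Set.range (Pi.basisFun ℝ (Fin n))) := hv
  rw [(Pi.basisFun ℝ (Fin n)).mem_span_iff_repr_mem ℤ] at hv'
  refine ⟨b.equivFun.symm v, ?_, ?_, ?_⟩
  · suffices h : b.equivFun.symm v ∈ AddSubgroup.toIntSubmodule L.toAddSubgroup from h
    rw [hL, b.mem_span_iff_repr_mem ℤ]
    intro i
    rw [← b.equivFun_apply, LinearEquiv.apply_symm_apply]
    exact hv' i
  · rw [Ne, LinearEquiv.map_eq_zero_iff]
    rintro rfl
    exact hv0 rfl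
  · have h1 : b.equivFun (a * b.equivFun.symm v) = f v := by
      have := Algebra.leftMulMatrix_mulVec_repr b a (b.equivFun.symm v)
      rw [← b.equivFun_apply, ← b.equivFun_apply, LinearEquiv.apply_symm_apply] at this
      rw [← this, hf, Matrix.toLin'_apply]
    rw [h1]
    simpa using hvs

/-- If `Lˣ` is finite and nonzero elements of `L` are invertible in `A`, then the set of elements of
norm `± 1` is bounded (compare Hey's theorem). -/
theorem exists_bound_of_finite_isUnitOf (hn : n ≠ 0) (hdiv : ∀ x ∈ L, x ≠ 0 → IsUnit x)
    (hfin : {x : A | IsUnitOf L x}.Finite) :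
    ∃ B : ℝ, ∀ a : A, |Algebra.norm ℝ a| = 1 → ‖b.equivFun a‖ ≤ B := by
  have hball : IsCompact (Metric.closedBall (0 : Fin n → ℝ) 2) := isCompact_closedBall _ _
  obtain ⟨K, hK⟩ := hball.bddAbove_image
    (Algebra.continuous_norm_equivFun_symm b).abs.continuousOn
  have hF := finite_abs_norm_le b hL hfin K
  set F := {x : A | x ∈ L ∧ Algebra.norm ℝ x ≠ 0 ∧ |Algebra.norm ℝ x| ≤ K}
  have hcompact : IsCompact (⋃ r ∈ F,
      (fun v => b.equivFun (b.equivFun.symm v * Ring.inverse r)) '' Metric.closedBall 0 2) := by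
    refine hF.isCompact_biUnion fun r _ => hball.image ?_
    exact LinearMap.continuous_of_finiteDimensional
      (b.equivFun.toLinearMap ∘ₗ LinearMap.mulRight ℝ (Ring.inverse r) ∘ₗ
        b.equivFun.symm.toLinearMap)
  obtain ⟨B, hB⟩ := hcompact.isBounded.exists_norm_le
  refine ⟨B, fun a ha => hB _ ?_⟩
  obtain ⟨r, hrL, hr0, hr⟩ := exists_ne_zero_norm_mul_le b hL hn ha
  have hru := hdiv r hrL hr0
  have hmem : b.equivFun (a * r) ∈ Metric.closedBall (0 : Fin n → ℝ) 2 := by simpa using hr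
  refine Set.mem_biUnion (x := r) ⟨hrL, (hru.map (Algebra.norm ℝ)).ne_zero, ?_⟩ ⟨_, hmem, ?_⟩
  · have h1 := hK ⟨_, hmem, rfl⟩
    simpa [abs_mul, ha] using h1
  · simp only [LinearEquiv.symm_apply_apply, mul_assoc, Ring.mul_inverse_cancel r hru, mul_one]

/-- If the elements of norm `± 1` are bounded, then `‖x‖ ^ n` is at most a multiple of `|N x|`, first
for units and then for all `x` by density, so nonzero elements are units. -/
theorem forall_isUnit_of_finite_isUnitOf [Nontrivial A] (hdiv : ∀ x ∈ L, x ≠ 0 → IsUnit x)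
    (hfin : {x : A | IsUnitOf L x}.Finite) (t : A) (ht : t ≠ 0) : IsUnit t := by
  have hn : n ≠ 0 := by
    rintro rfl
    exact not_subsingleton A b.equivFun.injective.subsingleton
  obtain ⟨B, hB⟩ := exists_bound_of_finite_isUnitOf b hL hn hdiv hfin
  have hunit : ∀ x : A, Algebra.norm ℝ x ≠ 0 →
      ‖b.equivFun x‖ ^ n ≤ B ^ n * |Algebra.norm ℝ x| := by
    intro x hx
    have hpos := abs_pos.mpr hx
    set s := |Algebra.norm ℝ x| ^ ((n : ℝ)⁻¹) with hs
    have hs0 : 0 < s := Real.rpow_pos_of_pos hpos _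
    have hsn : s ^ n = |Algebra.norm ℝ x| := Real.rpow_inv_natCast_pow hpos.le hn
    have h1 := hB (s⁻¹ • x) (by
      rw [Algebra.norm_smul_basis b, abs_mul, abs_of_pos (by positivity), inv_pow, hsn,
        inv_mul_cancel₀ hpos.ne'])
    rw [map_smul, norm_smul, norm_inv, Real.norm_of_nonneg hs0.le, inv_mul_le_iff₀ hs0] at h1
    calc ‖b.equivFun x‖ ^ n ≤ (s * B) ^ n := pow_le_pow_left₀ (norm_nonneg _) h1 n
      _ = B ^ n * |Algebra.norm ℝ x| := by rw [mul_pow, hsn, mul_comm]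
  have hline : Continuous fun e : ℝ => b.equivFun (t + e • (1 : A)) := by
    simp only [map_add, map_smul]
    fun_prop
  have hnorm : Continuous fun e : ℝ => Algebra.norm ℝ (t + e • (1 : A)) := by
    simpa only [Function.comp_def, LinearEquiv.symm_apply_apply] using
      (Algebra.continuous_norm_equivFun_symm b).comp hline
  have hclosed : IsClosed {e : ℝ | ‖b.equivFun (t + e • (1 : A))‖ ^ n ≤
      B ^ n * |Algebra.norm ℝ (t + e • (1 : A))|} :=
    isClosed_le (hline.norm.pow n) (continuous_const.mul hnorm.abs)
  have hdense : Dense {e : ℝ | Algebra.norm ℝ (t + e • (1 : A)) ≠ 0} := by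
    have hroots : {e : ℝ | Algebra.norm ℝ (t + e • (1 : A)) = 0}.Finite := by
      refine (Polynomial.finite_setOfPred_isRoot
        (Matrix.charpoly_monic (-Algebra.leftMulMatrix b t)).ne_zero).subset ?_
      intro e he
      have he' : Algebra.norm ℝ (t + e • (1 : A)) = 0 := he
      rw [Algebra.norm_eq_matrix_det b, map_add, map_smul, map_one] at he'
      change Polynomial.eval e _ = 0
      rw [Matrix.eval_charpoly, ← he', sub_neg_eq_add, add_comm, Matrix.scalar_apply,
        Matrix.smul_one_eq_diagonal]
    exact hroots.countable.dense_compl ℝ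
  have h0 : (0 : ℝ) ∈ {e : ℝ | ‖b.equivFun (t + e • (1 : A))‖ ^ n ≤
      B ^ n * |Algebra.norm ℝ (t + e • (1 : A))|} :=
    hclosed.closure_subset_iff.mpr (fun e he => hunit _ he) (hdense 0)
  simp only [Set.mem_ofPred_eq, zero_smul, add_zero] at h0
  apply Algebra.isUnit_of_norm_ne_zero b
  intro hN
  rw [hN, abs_zero, mul_zero] at h0
  have : 0 < ‖b.equivFun t‖ := norm_pos_iff.mpr (by simpa using ht)
  exact absurd h0 (by positivity : 0 < ‖b.equivFun t‖ ^ n).not_ge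

end RealAlgebra

theorem IsUnitOf.image_eq {A B : Type*} [Ring A] [Ring B] {f : A →+* B}
    (hf : Function.Injective f) (R : Subring A) :
    {x : B | IsUnitOf (R.map f) x} = f '' {x : A | IsUnitOf R x} := by
  ext x
  constructor
  · rintro ⟨⟨x, hx, rfl⟩, _, ⟨y, hy, rfl⟩, hxy, hyx⟩
    exact ⟨x, ⟨hx, y, hy, hf (by simpa using hxy), hf (by simpa using hyx)⟩, rfl⟩
  · rintro ⟨x, ⟨hx, y, hy, hxy, hyx⟩, rfl⟩
    exact ⟨⟨x, hx, rfl⟩, f y, ⟨y, hy, rfl⟩, by rw [← map_mul, hxy, map_one],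
      by rw [← map_mul, hyx, map_one]⟩

/-- For `D` a finite-dimensional division algebra over `ℚ` and `R` an order in
`D`, the unit group `Rˣ` is finite if and only if `ℝ ⊗[ℚ] D` is a division ring (every
nonzero element is a unit). -/
theorem stmt_8 {D : Type*} [DivisionRing D] [Algebra ℚ D] [FiniteDimensional ℚ D]
    (R : Subring D) (hR : IsOrder R) :
    {x : D | IsUnitOf R x}.Finite ↔ ∀ t : ℝ ⊗[ℚ] D, t ≠ 0 → IsUnit t := by
  obtain ⟨n, b, hb⟩ := hR.exists_basis
  let f : D →+* ℝ ⊗[ℚ] D := (Algebra.TensorProduct.includeRight : D →ₐ[ℚ] ℝ ⊗[ℚ] D).toRingHom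
  have hf : Function.Injective f :=
    Algebra.TensorProduct.includeRight_injective (algebraMap ℚ ℝ).injective
  have : Nontrivial (ℝ ⊗[ℚ] D) := hf.nontrivial
  have hL : AddSubgroup.toIntSubmodule (R.map f).toAddSubgroup =
      Submodule.span ℤ (Set.range (b.baseChange ℝ)) := by
    have h1 : Set.range (b.baseChange ℝ) = f.toAddMonoidHom.toIntLinearMap '' Set.range b := by
      rw [← Set.range_comp]
      congr 1
      ext i
      exact b.baseChange_apply ℝ i
    rw [h1, ← Submodule.map_span, ← hb]
    rfl
  have hdiv : ∀ x ∈ R.map f, x ≠ 0 → IsUnit x := by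
    rintro _ ⟨x, -, rfl⟩ hx
    exact (IsUnit.mk0 x (by rintro rfl; exact hx (map_zero f))).map f
  rw [← Set.finite_image_iff hf.injOn, ← IsUnitOf.image_eq hf]
  exact ⟨fun h => forall_isUnit_of_finite_isUnitOf (b.baseChange ℝ) hL hdiv h,
    fun h => finite_isUnitOf_of_forall_isUnit (b.baseChange ℝ) hL h⟩
end

section
/- With G a QI-group and W := (U + conj(U)) ∩ R^d, the decomposition of R^d into irreducible RG-modules is R^d = Fix(G) ⊕ ⊕_{α ∈ Γ₀} W^α, where Γ₀ = Gal((Q(χ)∩R)/Q); in particular W is an irreducible RG-module. Moreover, for w ∈ W^α and a in the rational centralizer A of G, one has ‖aw‖² = (conj(λ(a))·λ(a))^α · ‖w‖². -/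
open Matrix

/-- The rational permutation matrix of `σ`. -/
def permMat {d : ℕ} (σ : Equiv.Perm (Fin d)) : Matrix (Fin d) (Fin d) ℚ :=
  fun i j => if σ j = i then 1 else 0

/-- The fixed subspace of `G` in `ℝ^d`. -/
noncomputable def fixR {d : ℕ} (G : Subgroup (Equiv.Perm (Fin d))) :
    Submodule ℝ (Fin d → ℝ) where
  carrier := {v | ∀ σ ∈ G, ∀ i, v (σ i) = v i}
  add_mem' := by intro a b ha hb σ hσ i; simp [ha σ hσ i, hb σ hσ i]
  zero_mem' := by intro σ hσ i; rfl
  smul_mem' := by intro c a ha σ hσ i; simp [ha σ hσ i]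

/-- The real subspace `W^γ = (U^γ + conj(U^γ)) ∩ ℝ^d`, pulled back along the coordinatewise
embedding `ℝ^d → ℂ^d` (with `conj(U^γ) = U^{κγ}`). -/
noncomputable def Wsub {d : ℕ} {K : IntermediateField ℚ ℂ}
    (U : (K ≃ₐ[ℚ] K) → Submodule ℂ (Fin d → ℂ)) (κ γ : K ≃ₐ[ℚ] K) :
    Submodule ℝ (Fin d → ℝ) :=
  Submodule.comap (LinearMap.compLeft (Algebra.linearMap ℝ ℂ) (Fin d))
    ((U γ ⊔ U (κ * γ)).restrictScalars ℝ)

theorem commute_permMat_iff {d : ℕ} (a : Matrix (Fin d) (Fin d) ℚ) (σ : Equiv.Perm (Fin d)) :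
    a * permMat σ = permMat σ * a ↔ ∀ i j, a (σ i) (σ j) = a i j := by
  have hl : ∀ i j, (a * permMat σ) i j = a i (σ j) := by
    intro i j
    simp [Matrix.mul_apply, permMat]
  have hr : ∀ i j, (permMat σ * a) (σ i) j = a i j := by
    intro i j
    simp [Matrix.mul_apply, permMat]
  constructor
  · intro h i j
    rw [← hl, h, hr]
  · intro h
    ext i j
    obtain ⟨i, rfl⟩ := σ.surjective i
    rw [hl, hr, h]

/-- An invariant complex matrix is a complex combination of invariant rational matrices, so it acts
as a scalar on every subspace on which the latter do. -/
theorem exists_scalar_of_invariant {d : ℕ} {G : Subgroup (Equiv.Perm (Fin d))}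
    {V : Submodule ℂ (Fin d → ℂ)}
    (hV : ∀ a : Matrix (Fin d) (Fin d) ℚ, (∀ σ ∈ G, ∀ i j, a (σ i) (σ j) = a i j) →
      ∃ c : ℂ, ∀ v ∈ V, (a.map (algebraMap ℚ ℂ)).mulVec v = c • v)
    (M : Matrix (Fin d) (Fin d) ℂ) (hM : ∀ σ ∈ G, ∀ i j, M (σ i) (σ j) = M i j) :
    ∃ c : ℂ, ∀ v ∈ V, M.mulVec v = c • v := by
  classical
  let S : Finset ℂ := Finset.univ.image fun p : Fin d × Fin d => M p.1 p.2
  let a : ℂ → Matrix (Fin d) (Fin d) ℚ := fun z i j => if M i j = z then 1 else 0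
  have ha : ∀ z, ∀ σ ∈ G, ∀ i j, a z (σ i) (σ j) = a z i j := by
    intro z σ hσ i j
    simp only [a, hM σ hσ i j]
  choose c hc using fun z => hV (a z) (ha z)
  have hMa : M = ∑ z ∈ S, z • (a z).map (algebraMap ℚ ℂ) := by
    ext i j
    have hmem : M i j ∈ S := Finset.mem_image.2 ⟨(i, j), Finset.mem_univ _, rfl⟩
    simp [Matrix.sum_apply, a, Matrix.map_apply (M := fun i j => ite _ _ _), apply_ite, hmem]
  refine ⟨∑ z ∈ S, z * c z, fun v hv => ?_⟩
  conv_lhs => rw [hMa]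
  rw [Matrix.sum_mulVec, Finset.sum_smul]
  refine Finset.sum_congr rfl fun z _ => ?_
  rw [Matrix.smul_mulVec, hc z v hv, smul_smul]

theorem exists_invariant_projection {d : ℕ} {G : Subgroup (Equiv.Perm (Fin d))}
    {W : Submodule ℝ (Fin d → ℝ)} (hW : ∀ σ ∈ G, ∀ v ∈ W, v ∘ ⇑σ ∈ W) :
    ∃ P : Matrix (Fin d) (Fin d) ℝ, (∀ σ ∈ G, ∀ i j, P (σ i) (σ j) = P i j) ∧
      (∀ x, P.mulVec x ∈ W) ∧ ∀ x ∈ W, P.mulVec x = x := by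
  let E : EuclideanSpace ℝ (Fin d) ≃ₗ[ℝ] (Fin d → ℝ) := WithLp.linearEquiv 2 ℝ (Fin d → ℝ)
  let W₂ : Submodule ℝ (EuclideanSpace ℝ (Fin d)) := W.comap E.toLinearMap
  let p : (Fin d → ℝ) →ₗ[ℝ] (Fin d → ℝ) :=
    E.toLinearMap ∘ₗ W₂.starProjection.toLinearMap ∘ₗ E.symm.toLinearMap
  have hpW : ∀ x, p x ∈ W := fun x => W₂.starProjection_apply_mem (E.symm x)
  have hpid : ∀ x ∈ W, p x = x := by
    intro x hx
    have h : W₂.starProjection (E.symm x) = E.symm x :=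
      Submodule.starProjection_eq_self_iff.2 (by simpa [W₂] using hx)
    change E (W₂.starProjection (E.symm x)) = x
    rw [h, E.apply_symm_apply]
  have hpσ : ∀ σ ∈ G, ∀ x, p (x ∘ ⇑σ) = p x ∘ ⇑σ := by
    intro σ hσ x
    have h : W₂.starProjection (E.symm (x ∘ ⇑σ)) = E.symm (p x ∘ ⇑σ) := by
      refine Submodule.eq_starProjection_of_mem_of_inner_eq_zero ?_ ?_
      · change E (E.symm (p x ∘ ⇑σ)) ∈ W
        rw [E.apply_symm_apply]
        exact hW σ hσ _ (hpW x)
      · intro w hw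
        have hw' : E.symm (E w ∘ ⇑σ⁻¹) ∈ W₂ := by
          change E (E.symm (E w ∘ ⇑σ⁻¹)) ∈ W
          rw [E.apply_symm_apply]
          exact hW _ (G.inv_mem hσ) _ hw
        have h0 := W₂.starProjection_inner_eq_zero (E.symm x) _ hw'
        rw [← h0, PiLp.inner_apply, PiLp.inner_apply,
          ← Equiv.sum_comp σ fun i => inner ℝ (_ : ℝ) ((E.symm (E w ∘ ⇑σ⁻¹)).ofLp i)]
        refine Finset.sum_congr rfl fun i _ => ?_
        simp [E, p]
    change E (W₂.starProjection (E.symm (x ∘ ⇑σ))) = _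
    rw [h, E.apply_symm_apply]
  refine ⟨LinearMap.toMatrix' p, fun σ hσ i j => ?_, fun x => ?_, fun x hx => ?_⟩
  · have hs : (Pi.single (σ j) 1 : Fin d → ℝ) ∘ ⇑σ = Pi.single j 1 := by
      ext k
      simp [Pi.single_apply]
    rw [LinearMap.toMatrix'_apply, LinearMap.toMatrix'_apply, ← hs, hpσ σ hσ]
    rfl
  · rw [LinearMap.toMatrix'_mulVec]
    exact hpW x
  · rw [LinearMap.toMatrix'_mulVec]
    exact hpid x hx

theorem mem_Wsub {d : ℕ} {K : IntermediateField ℚ ℂ}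
    {U : (K ≃ₐ[ℚ] K) → Submodule ℂ (Fin d → ℂ)} {κ γ : K ≃ₐ[ℚ] K} {w : Fin d → ℝ} :
    w ∈ Wsub U κ γ ↔ (fun i => (w i : ℂ)) ∈ U γ ⊔ U (κ * γ) :=
  Iff.rfl

theorem re_mem_Wsub {d : ℕ} {K : IntermediateField ℚ ℂ}
    {U : (K ≃ₐ[ℚ] K) → Submodule ℂ (Fin d → ℂ)} {κ γ : K ≃ₐ[ℚ] K}
    (hconj : ∀ v : Fin d → ℂ, v ∈ U γ → (fun i => starRingEnd ℂ (v i)) ∈ U (κ * γ))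
    {u : Fin d → ℂ} (hu : u ∈ U γ) : (fun i => (u i).re) ∈ Wsub U κ γ := by
  rw [mem_Wsub]
  have h : (fun i => ((u i).re : ℂ)) =
      (2⁻¹ : ℂ) • u + (2⁻¹ : ℂ) • fun i => starRingEnd ℂ (u i) := by
    ext i
    simp only [Pi.add_apply, Pi.smul_apply, smul_eq_mul, Complex.re_eq_add_conj]
    ring
  rw [h]
  exact Submodule.add_mem_sup (Submodule.smul_mem _ _ hu)
    (Submodule.smul_mem _ _ (hconj u hu))

/-- A real matrix acting on `U γ` as the real scalar `c` acts on `Wsub U κ γ` as `c`. -/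
theorem mulVec_eq_smul_of_mem_Wsub {d : ℕ} {K : IntermediateField ℚ ℂ}
    {U : (K ≃ₐ[ℚ] K) → Submodule ℂ (Fin d → ℂ)} {κ γ : K ≃ₐ[ℚ] K} (hκ : κ * (κ * γ) = γ)
    (hconj : ∀ γ, ∀ v : Fin d → ℂ, v ∈ U γ → (fun i => starRingEnd ℂ (v i)) ∈ U (κ * γ))
    {P : Matrix (Fin d) (Fin d) ℝ} {c : ℝ}
    (hP : ∀ v ∈ U γ, (P.map (algebraMap ℝ ℂ)).mulVec v = (c : ℂ) • v)
    {w : Fin d → ℝ} (hw : w ∈ Wsub U κ γ) : P.mulVec w = c • w := by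
  obtain ⟨x, hx, y, hy, hxy⟩ := Submodule.mem_sup.1 (mem_Wsub.1 hw)
  have hy' := hconj _ y hy
  rw [hκ] at hy'
  have hPy : (P.map (algebraMap ℝ ℂ)).mulVec y = (c : ℂ) • y := by
    ext i
    have h := congrArg (starRingEnd ℂ) (congrFun (hP _ hy') i)
    simpa [Matrix.mulVec, dotProduct] using h
  have h : (P.map (algebraMap ℝ ℂ)).mulVec (fun i => (w i : ℂ)) =
      (c : ℂ) • fun i => (w i : ℂ) := by
    rw [← hxy, Matrix.mulVec_add, hP x hx, hPy, smul_add]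
  ext i
  have hi := congrFun h i
  simp only [Matrix.mulVec, dotProduct, Matrix.map_apply, Complex.coe_algebraMap, Pi.smul_apply,
    smul_eq_mul] at hi ⊢
  exact_mod_cast hi

/-- If the invariant rational matrices act by scalars on `U γ`, then a subspace of `Wsub U κ γ`
stable under `G` is trivial or everything. -/
theorem eq_bot_or_eq_Wsub {d : ℕ} {G : Subgroup (Equiv.Perm (Fin d))} {K : IntermediateField ℚ ℂ}
    {U : (K ≃ₐ[ℚ] K) → Submodule ℂ (Fin d → ℂ)} {κ γ : K ≃ₐ[ℚ] K} (hκ : κ * (κ * γ) = γ)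
    (hne : U γ ≠ ⊥)
    (hconj : ∀ γ, ∀ v : Fin d → ℂ, v ∈ U γ → (fun i => starRingEnd ℂ (v i)) ∈ U (κ * γ))
    (hscal : ∀ a : Matrix (Fin d) (Fin d) ℚ, (∀ σ ∈ G, ∀ i j, a (σ i) (σ j) = a i j) →
      ∃ c : ℂ, ∀ v ∈ U γ, (a.map (algebraMap ℚ ℂ)).mulVec v = c • v)
    {W : Submodule ℝ (Fin d → ℝ)} (hle : W ≤ Wsub U κ γ)
    (hW : ∀ σ ∈ G, ∀ v ∈ W, v ∘ ⇑σ ∈ W) : W = ⊥ ∨ W = Wsub U κ γ := by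
  obtain ⟨P, hPG, hPW, hPid⟩ := exists_invariant_projection hW
  obtain ⟨c, hc⟩ := exists_scalar_of_invariant hscal (P.map (algebraMap ℝ ℂ))
    (fun σ hσ i j => by simp [hPG σ hσ i j])
  have hPP : P * P = P := by
    refine Matrix.toLin'.injective (LinearMap.ext fun x => ?_)
    simp only [Matrix.toLin'_apply, ← Matrix.mulVec_mulVec]
    exact hPid _ (hPW x)
  have hcc : c = 0 ∨ c = 1 := by
    obtain ⟨u, hu, hu0⟩ := Submodule.exists_mem_ne_zero_of_ne_bot hne
    have h2 : (c * c) • u = c • u := by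
      calc (c * c) • u = (P.map (algebraMap ℝ ℂ)).mulVec ((P.map (algebraMap ℝ ℂ)).mulVec u) := by
            rw [hc u hu, Matrix.mulVec_smul, hc u hu, smul_smul]
        _ = c • u := by
            rw [Matrix.mulVec_mulVec, ← Matrix.map_mul, hPP, hc u hu]
    have h3 : c * c = c := smul_left_injective ℂ hu0 h2
    by_cases h0 : c = 0
    · exact Or.inl h0
    · exact Or.inr (mul_left_cancel₀ h0 (by rw [h3, mul_one]))
  rcases hcc with rfl | rfl
  · refine Or.inl ((Submodule.eq_bot_iff _).2 fun x hx => ?_)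
    have h := mulVec_eq_smul_of_mem_Wsub (P := P) (c := 0) hκ hconj (by simpa using hc) (hle hx)
    rw [← hPid x hx, h, zero_smul]
  · refine Or.inr (le_antisymm hle fun x hx => ?_)
    have h := mulVec_eq_smul_of_mem_Wsub (P := P) (c := 1) hκ hconj (by simpa using hc) hx
    rw [one_smul] at h
    rw [← h]
    exact hPW x

open scoped ComplexOrder in
/-- If `a` and its transpose act on a nonzero vector as scalars, these scalars are conjugate. -/
theorem eq_conj_of_transpose_mulVec {d : ℕ} {a : Matrix (Fin d) (Fin d) ℚ} {v : Fin d → ℂ}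
    (hv : v ≠ 0) {b c : ℂ} (hb : (aᵀ.map (algebraMap ℚ ℂ)).mulVec v = b • v)
    (hc : (a.map (algebraMap ℚ ℂ)).mulVec v = c • v) : b = starRingEnd ℂ c := by
  have hH : aᵀ.map (algebraMap ℚ ℂ) = (a.map (algebraMap ℚ ℂ))ᴴ := by
    ext i j
    simp
  have h : b * (star v ⬝ᵥ v) = starRingEnd ℂ c * (star v ⬝ᵥ v) := by
    calc b * (star v ⬝ᵥ v) = star v ⬝ᵥ (aᵀ.map (algebraMap ℚ ℂ)).mulVec v := by
          rw [hb, dotProduct_smul, smul_eq_mul]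
      _ = star ((a.map (algebraMap ℚ ℂ)).mulVec v) ⬝ᵥ v := by
          rw [hH, Matrix.dotProduct_mulVec, Matrix.star_mulVec]
      _ = starRingEnd ℂ c * (star v ⬝ᵥ v) := by
          rw [hc, star_smul, smul_dotProduct, smul_eq_mul]
          rfl
  exact mul_right_cancel₀ (fun h0 => hv (dotProduct_star_self_eq_zero.1 h0)) h

/-- Blocks of an independent family over pairwise disjoint index sets are independent, also after
restriction to real vectors. -/
theorem iSupIndep_of_le_comap {d : ℕ} {ι κ : Type*} {V : ι → Submodule ℂ (Fin d → ℂ)}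
    (hV : iSupIndep V) {W : κ → Submodule ℝ (Fin d → ℝ)} {S : κ → Set ι}
    (hS : Pairwise fun o o' => Disjoint (S o) (S o'))
    (hW : ∀ o, ∀ w ∈ W o, (fun i => (w i : ℂ)) ∈ ⨆ j ∈ S o, V j) : iSupIndep W := by
  intro o
  rw [Submodule.disjoint_def]
  intro x hx hx'
  let S' : Set ι := ⋃ o' ∈ {o' | o' ≠ o}, S o'
  have hdisj : Disjoint (S o) S' := by
    simp only [S', Set.disjoint_iUnion_right]
    exact fun o' ho' => hS (Ne.symm ho')
  have hle : (⨆ (o') (_ : o' ≠ o), W o') ≤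
      Submodule.comap (LinearMap.compLeft (Algebra.linearMap ℝ ℂ) (Fin d))
        ((⨆ j ∈ S', V j).restrictScalars ℝ) := by
    refine iSup₂_le fun o' ho' w hw => ?_
    have hsub : S o' ⊆ S' := Set.subset_biUnion_of_mem (u := S) ho'
    exact (biSup_mono hsub : (⨆ j ∈ S o', V j) ≤ ⨆ j ∈ S', V j) (hW o' w hw)
  have h0 := Submodule.disjoint_def.1 (hV.disjoint_biSup_biSup hdisj) _ (hW o x hx) (hle hx')
  ext i
  exact Complex.ofReal_eq_zero.1 (congrFun h0 i)

/-- For a QI-group `G`, with `W = (U + conj U) ∩ ℝ^d`, the space `ℝ^d`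
decomposes into irreducible `ℝG`-modules as `Fix(G) ⊕ ⊕_{α∈Γ₀} W^α`, where `Γ₀` is a set
of representatives of `Gal(ℚ(χ)/ℚ)` modulo complex conjugation `κ`; in particular each
`W^α` is irreducible.  Moreover for `w ∈ W^α` and `a` in the rational centralizer `A`,
`‖aw‖² = (conj(λ(a))·λ(a))^α·‖w‖²`. -/
theorem stmt_15 {d : ℕ} (G : Subgroup (Equiv.Perm (Fin d))) [Fintype G]
    (htrans : ∀ i j : Fin d, ∃ σ ∈ G, σ i = j)
    (hQI : ∀ W : Submodule ℚ (Fin d → ℚ), (∀ x ∈ W, ∑ i, x i = 0) →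
      (∀ σ ∈ G, ∀ x ∈ W, x ∘ ⇑σ ∈ W) →
      W = ⊥ ∨ (W : Set (Fin d → ℚ)) = {x | ∑ i, x i = 0})
    (K : IntermediateField ℚ ℂ) [FiniteDimensional ℚ K] [DecidableEq (K ≃ₐ[ℚ] K)]
    (U : (K ≃ₐ[ℚ] K) → Submodule ℂ (Fin d → ℂ))
    (hUne : ∀ γ, U γ ≠ ⊥)
    (hUinv : ∀ γ, ∀ σ ∈ G, ∀ v ∈ U γ, (v ∘ ⇑σ) ∈ U γ)
    (hUirr : ∀ γ, ∀ W ≤ U γ, (∀ σ ∈ G, ∀ v ∈ W, (v ∘ ⇑σ) ∈ W) → W = ⊥ ∨ W = U γ)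
    (κ : K ≃ₐ[ℚ] K) (hκ : ∀ x : K, ((κ x : K) : ℂ) = starRingEnd ℂ (x : ℂ))
    (hUconj : ∀ γ, ∀ v : Fin d → ℂ, v ∈ U γ →
      (fun i => starRingEnd ℂ (v i)) ∈ U (κ * γ))
    (hdecC : DirectSum.IsInternal
      (fun o : Option (K ≃ₐ[ℚ] K) =>
        o.elim
          ({ carrier := {v | ∀ σ ∈ G, ∀ i, v (σ i) = v i},
             add_mem' := by intro a b ha hb σ hσ i; simp [ha σ hσ i, hb σ hσ i],
             zero_mem' := by intro σ hσ i; rfl,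
             smul_mem' := by intro c a ha σ hσ i; simp [ha σ hσ i] } :
            Submodule ℂ (Fin d → ℂ)) U))
    (lf : Matrix (Fin d) (Fin d) ℚ → K)
    (hlf : ∀ a : Matrix (Fin d) (Fin d) ℚ, (∀ σ ∈ G, a * permMat σ = permMat σ * a) →
      ∀ γ : K ≃ₐ[ℚ] K, ∀ v ∈ U γ,
        (a.map (algebraMap ℚ ℂ)).mulVec v = ((γ (lf a) : K) : ℂ) • v) :
    (∀ γ : K ≃ₐ[ℚ] K, Wsub U κ γ ≠ ⊥ ∧
      (∀ σ ∈ G, ∀ v ∈ Wsub U κ γ, (v ∘ ⇑σ) ∈ Wsub U κ γ) ∧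
      ∀ W' ≤ Wsub U κ γ, (∀ σ ∈ G, ∀ v ∈ W', (v ∘ ⇑σ) ∈ W') →
        W' = ⊥ ∨ W' = Wsub U κ γ) ∧
    (∀ T : Finset (K ≃ₐ[ℚ] K),
      (∀ γ : K ≃ₐ[ℚ] K, ∃! τ, τ ∈ T ∧ (γ = τ ∨ γ = κ * τ)) →
      DirectSum.IsInternal
        (fun o : Option {τ // τ ∈ T} =>
          o.elim (fixR G) (fun τ => Wsub U κ τ.1))) ∧
    (∀ a : Matrix (Fin d) (Fin d) ℚ, (∀ σ ∈ G, a * permMat σ = permMat σ * a) →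
      ∀ γ : K ≃ₐ[ℚ] K, ∀ w ∈ Wsub U κ γ,
        algebraMap ℝ ℂ (∑ i, ((a.map (algebraMap ℚ ℝ)).mulVec w) i ^ 2) =
          ((γ (κ (lf a) * lf a) : K) : ℂ) * algebraMap ℝ ℂ (∑ i, (w i) ^ 2)) := by
  classical
  have hκκ : ∀ γ, κ * (κ * γ) = γ := by
    intro γ
    ext x
    simp [hκ]
  have hscal : ∀ γ, ∀ a : Matrix (Fin d) (Fin d) ℚ,
      (∀ σ ∈ G, ∀ i j, a (σ i) (σ j) = a i j) →
      ∃ c : ℂ, ∀ v ∈ U γ, (a.map (algebraMap ℚ ℂ)).mulVec v = c • v := fun γ a ha =>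
    ⟨_, hlf a (fun σ hσ => (commute_permMat_iff a σ).2 (ha σ hσ)) γ⟩
  refine ⟨fun γ => ⟨?_, ?_, fun W' hle hW' =>
    eq_bot_or_eq_Wsub (hκκ γ) (hUne γ) hUconj (hscal γ) hle hW'⟩, ?_, ?_⟩
  · intro h
    refine hUne γ ((Submodule.eq_bot_iff _).2 fun u hu => ?_)
    have h1 := re_mem_Wsub (hUconj γ) hu
    have h2 := re_mem_Wsub (hUconj γ) (Submodule.smul_mem _ Complex.I hu)
    rw [h, Submodule.mem_bot] at h1 h2
    ext i
    refine Complex.ext (congrFun h1 i) ?_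
    simpa using congrFun h2 i
  · intro σ hσ v hv
    obtain ⟨x, hx, y, hy, hxy⟩ := Submodule.mem_sup.1 (mem_Wsub.1 hv)
    refine mem_Wsub.2 (Submodule.mem_sup.2
      ⟨_, hUinv _ σ hσ x hx, _, hUinv _ σ hσ y hy, ?_⟩)
    ext i
    exact congrFun hxy (σ i)
  · intro T hT
    have hC := (DirectSum.isInternal_submodule_iff_iSupIndep_and_iSup_eq_top _).1 hdecC
    refine (DirectSum.isInternal_submodule_iff_iSupIndep_and_iSup_eq_top _).2 ⟨?_, ?_⟩
    · refine iSupIndep_of_le_comap hC.1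
        (S := fun o => o.elim {none} fun τ => {some τ.1, some (κ * τ.1)}) ?_ ?_
      · have hdisj : ∀ τ ∈ T, ∀ τ' ∈ T, τ ≠ τ' →
            Disjoint {some τ, some (κ * τ)} ({some τ', some (κ * τ')} : Set (Option _)) := by
          intro τ hτ τ' hτ' hne
          rw [Set.disjoint_left]
          have aux : ∀ γ, (γ = τ ∨ γ = κ * τ) → (γ = τ' ∨ γ = κ * τ') → False :=
            fun γ h h' => hne ((hT γ).unique ⟨hτ, h⟩ ⟨hτ', h'⟩)
          rintro (_ | γ) h h'
          · simp at h
          · exact aux γ (by simpa using h) (by simpa using h')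
        rintro (_ | τ) (_ | τ') hne
        · exact absurd rfl hne
        · simp
        · simp
        · exact hdisj _ τ.2 _ τ'.2 fun h => hne (congrArg some (Subtype.ext h))
      · rintro (_ | τ) w hw
        · refine Submodule.mem_iSup_of_mem none (Submodule.mem_iSup_of_mem rfl ?_)
          intro σ hσ i
          exact congrArg Complex.ofReal (hw σ hσ i)
        · change _ ∈ ⨆ j ∈ ({some τ.1, some (κ * τ.1)} : Set (Option (K ≃ₐ[ℚ] K))), _
          rw [iSup_pair]
          exact hw
    · rw [eq_top_iff]
      rintro v -
      obtain ⟨x, rfl⟩ : ∃ x : Fin d → ℂ, (fun i => (x i).re) = v := ⟨fun i => (v i : ℂ), rfl⟩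
      have hx : x ∈ (⊤ : Submodule ℂ (Fin d → ℂ)) := trivial
      rw [← hC.2] at hx
      induction hx using Submodule.iSup_induction' with
      | mem o x hx =>
        rcases o with _ | γ
        · refine Submodule.mem_iSup_of_mem none ?_
          intro σ hσ i
          exact congrArg Complex.re (hx σ hσ i)
        · obtain ⟨τ, ⟨hτ, h⟩, -⟩ := hT γ
          refine Submodule.mem_iSup_of_mem (some ⟨τ, hτ⟩) ?_
          have hmem := re_mem_Wsub (hUconj γ) hx
          rcases h with rfl | rfl
          · exact hmem
          · rw [mem_Wsub, hκκ, sup_comm] at hmem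
            exact mem_Wsub.2 hmem
      | zero => exact Submodule.zero_mem _
      | add x y _ _ hx hy => exact Submodule.add_mem _ hx hy
  · intro a ha γ w hw
    have haT : ∀ σ ∈ G, aᵀ * permMat σ = permMat σ * aᵀ := fun σ hσ =>
      (commute_permMat_iff _ σ).2 fun i j => (commute_permMat_iff a σ).1 (ha σ hσ) j i
    have hT : ∀ γ : K ≃ₐ[ℚ] K, ((γ (lf aᵀ) : K) : ℂ) = starRingEnd ℂ ((γ (lf a) : K) : ℂ) := by
      intro γ
      obtain ⟨u, hu, hu0⟩ := Submodule.exists_mem_ne_zero_of_ne_bot (hUne γ)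
      exact eq_conj_of_transpose_mulVec hu0 (hlf _ haT γ u hu) (hlf a ha γ u hu)
    have hκa : κ (lf a) = lf aᵀ := by
      apply Subtype.ext
      rw [hκ]
      exact (hT 1).symm
    have hc : ((γ (κ (lf a) * lf a) : K) : ℂ) =
        ((Complex.normSq ((γ (lf a) : K) : ℂ) : ℝ) : ℂ) := by
      rw [hκa, map_mul, MulMemClass.coe_mul, hT, Complex.normSq_eq_conj_mul_self]
    rw [hc]
    have hP : ∀ v ∈ U γ, (((aᵀ * a).map (algebraMap ℚ ℝ)).map (algebraMap ℝ ℂ)).mulVec v =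
        ((Complex.normSq ((γ (lf a) : K) : ℂ) : ℝ) : ℂ) • v := by
      intro v hv
      have : ((aᵀ * a).map (algebraMap ℚ ℝ)).map (algebraMap ℝ ℂ) =
          aᵀ.map (algebraMap ℚ ℂ) * a.map (algebraMap ℚ ℂ) := by
        rw [← Matrix.map_mul]
        ext i j
        simp only [Matrix.map_apply, ← IsScalarTower.algebraMap_apply]
      rw [this, ← Matrix.mulVec_mulVec, hlf a ha γ v hv, Matrix.mulVec_smul, hlf _ haT γ v hv,
        smul_smul, hT, Complex.normSq_eq_conj_mul_self, mul_comm]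
    have hw' := mulVec_eq_smul_of_mem_Wsub (hκκ γ) hUconj hP hw
    have hsq : ∀ x : Fin d → ℝ, ∑ i, x i ^ 2 = x ⬝ᵥ x := fun x => by
      simp [dotProduct, sq]
    have key : ∑ i, ((a.map (algebraMap ℚ ℝ)).mulVec w) i ^ 2 =
        Complex.normSq ((γ (lf a) : K) : ℂ) * ∑ i, w i ^ 2 := by
      rw [hsq, hsq, ← smul_eq_mul, ← dotProduct_smul, ← hw', Matrix.map_mul,
        ← Matrix.mulVec_mulVec, Matrix.transpose_map, Matrix.dotProduct_mulVec w,
        Matrix.vecMul_transpose]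
    rw [key]
    simp
end

section
/- Let G ≤ S_d be a QI-group. Then there is a constant M depending only on G such that every core point for G (with respect to Z^d) is normalizer equivalent to a core point w with ‖w‖² ≤ M. In particular, there are only finitely many core points for G up to normalizer equivalence. -/
/-- The set of integer vectors in `ℝ^d`. -/
def intVecs (d : ℕ) : Set (Fin d → ℝ) := {x | ∀ i, ∃ k : ℤ, x i = (k : ℝ)}

/-- The orbit of `z` under a permutation group `G` acting by permuting coordinates. -/
def permOrbit {d : ℕ} (G : Subgroup (Equiv.Perm (Fin d))) (z : Fin d → ℝ) :
    Set (Fin d → ℝ) :=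
  {x | ∃ σ ∈ G, x = z ∘ ⇑σ}

/-- `z` is a core point for `G`: an integral point such that the only integer points of the
convex hull of its orbit are the orbit points themselves. -/
def IsCorePoint {d : ℕ} (G : Subgroup (Equiv.Perm (Fin d))) (z : Fin d → ℝ) : Prop :=
  z ∈ intVecs d ∧ convexHull ℝ (permOrbit G z) ∩ intVecs d = permOrbit G z

/-- `G` is transitive on the `d` coordinates. -/
def IsTransitivePerm {d : ℕ} (G : Subgroup (Equiv.Perm (Fin d))) : Prop :=
  ∀ i j : Fin d, ∃ σ ∈ G, σ i = j

/-- `G` is a QI-group: transitive, and the rational zero-sum subspace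
`Fix(G)^⊥ ∩ ℚ^d` is a simple `ℚG`-module. -/
def IsQIGroup {d : ℕ} (G : Subgroup (Equiv.Perm (Fin d))) : Prop :=
  IsTransitivePerm G ∧
  ∀ W : Submodule ℚ (Fin d → ℚ), (∀ x ∈ W, ∑ i, x i = 0) →
    (∀ σ ∈ G, ∀ x ∈ W, x ∘ ⇑σ ∈ W) →
    W = ⊥ ∨ (W : Set (Fin d → ℚ)) = {x | ∑ i, x i = 0}

/-- Normalizer equivalence: `w = S z + b` with `S ∈ GL(d,ℤ)` normalizing the group of
permutation matrices of `G` and `b` a `G`-fixed integer vector. -/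
def NormEquiv {d : ℕ} (G : Subgroup (Equiv.Perm (Fin d))) (z w : Fin d → ℝ) : Prop :=
  ∃ (S : (Fin d → ℝ) ≃ₗ[ℝ] (Fin d → ℝ)) (b : Fin d → ℝ),
    ⇑S '' intVecs d = intVecs d ∧
    (∀ σ ∈ G, ∃ τ ∈ G, ∀ x : Fin d → ℝ, S (x ∘ ⇑σ) = (S x) ∘ ⇑τ) ∧
    b ∈ intVecs d ∧ (∀ σ ∈ G, b ∘ ⇑σ = b) ∧
    w = S z + b

open MeasureTheory in
/-- Minkowski's theorem on linear forms, in Euclidean form. -/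
theorem exists_int_ne_zero_mulVec_le {r : ℕ} (hr : 0 < r) (B : Matrix (Fin r) (Fin r) ℝ)
    (hB : B.det ≠ 0) :
    ∃ a : Fin r → ℤ, a ≠ 0 ∧
      ((B.mulVec fun i => (a i : ℝ)) ⬝ᵥ (B.mulVec fun i => (a i : ℝ))) ^ r
        ≤ (r : ℝ) ^ r * B.det ^ 2 := by
  have : NeZero r := ⟨hr.ne'⟩
  let e : (Fin r → ℝ) ≃ₗ[ℝ] (Fin r → ℝ) :=
    Matrix.toLinearEquiv' B (Matrix.invertibleOfIsUnitDet B hB.isUnit)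
  have he : ∀ x, e x = B.mulVec x := fun x => rfl
  let b : Module.Basis (Fin r) ℝ (Fin r → ℝ) := (Pi.basisFun ℝ (Fin r)).map e
  have hb : Matrix.of b = B.transpose := by
    ext i j
    simp [b, he]
  set δ : ℝ := |B.det| ^ ((1 : ℝ) / r) with hδ
  have hδ0 : 0 ≤ δ := by positivity
  have hδr : δ ^ r = |B.det| := by
    rw [hδ, ← Real.rpow_natCast, ← Real.rpow_mul (abs_nonneg _)]
    field_simp
    simp
  have hfund := ZSpan.isAddFundamentalDomain b (volume : Measure (Fin r → ℝ))
  have : Countable (Submodule.span ℤ (Set.range b)).toAddSubgroup :=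
    inferInstanceAs (Countable (Submodule.span ℤ (Set.range b)))
  have : DiscreteTopology (Submodule.span ℤ (Set.range b)).toAddSubgroup :=
    inferInstanceAs (DiscreteTopology (Submodule.span ℤ (Set.range b)))
  obtain ⟨x, hx0, hx⟩ := exists_ne_zero_mem_lattice_of_measure_mul_two_pow_le_measure
    (L := (Submodule.span ℤ (Set.range b)).toAddSubgroup) (s := Metric.closedBall 0 δ)
    hfund (by simp) (convex_closedBall 0 δ) (isCompact_closedBall 0 δ) (by
      rw [ZSpan.volume_fundamentalDomain, Real.volume_pi_closedBall _ hδ0, hb,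
        Matrix.det_transpose, mul_pow, Fintype.card_fin, hδr, Module.finrank_fin_fun,
        ENNReal.ofReal_mul (by positivity), mul_comm]
      simp [ENNReal.ofReal_pow])
  obtain ⟨a, ha⟩ := (Submodule.mem_span_range_iff_exists_fun ℤ).1 x.2
  have hax : (B.mulVec fun i => (a i : ℝ)) = x := by
    rw [← ha]
    ext k
    simp [b, he, Matrix.mulVec, dotProduct, mul_comm]
  refine ⟨a, ?_, ?_⟩
  · rintro rfl
    apply hx0
    ext1
    rw [← hax]
    ext k
    simp [Matrix.mulVec, dotProduct]
  · rw [hax]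
    have hle : (x : Fin r → ℝ) ⬝ᵥ (x : Fin r → ℝ) ≤ r * δ ^ 2 := by
      rw [dotProduct]
      calc _ ≤ ∑ _i : Fin r, δ ^ 2 := by
            refine Finset.sum_le_sum fun i _ => ?_
            have h1 : |(x : Fin r → ℝ) i| ≤ δ :=
              (norm_le_pi_norm (x : Fin r → ℝ) i).trans (by simpa using hx)
            rw [← sq, ← sq_abs]
            gcongr
        _ = r * δ ^ 2 := by simp
    calc _ ≤ (r * δ ^ 2) ^ r := by
          gcongr
          exact Finset.sum_nonneg fun i _ => mul_self_nonneg _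
      _ = r ^ r * B.det ^ 2 := by
          rw [mul_pow, ← pow_mul, mul_comm 2 r, pow_mul, hδr, sq_abs]

theorem dotProduct_mulVec_self {m n : ℕ} (X : Matrix (Fin m) (Fin n) ℝ) (a : Fin n → ℝ) :
    X.mulVec a ⬝ᵥ X.mulVec a = a ⬝ᵥ (X.transpose * X).mulVec a := by
  rw [← Matrix.mulVec_mulVec, Matrix.dotProduct_mulVec a, Matrix.vecMul_transpose]

/-- Hermite's bound: the minimum of a Gram form in terms of its determinant. -/
theorem exists_int_ne_zero_gram_le {m r : ℕ} (hr : 0 < r) (X : Matrix (Fin m) (Fin r) ℝ)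
    (hX : (X.transpose * X).det ≠ 0) :
    ∃ a : Fin r → ℤ, a ≠ 0 ∧
      ((X.mulVec fun i => (a i : ℝ)) ⬝ᵥ (X.mulVec fun i => (a i : ℝ))) ^ r
        ≤ (r : ℝ) ^ r * (X.transpose * X).det := by
  obtain ⟨B, hB⟩ : ∃ B : Matrix (Fin r) (Fin r) ℝ, X.transpose * X = B.transpose * B := by
    have h := Matrix.posSemidef_conjTranspose_mul_self X
    open scoped MatrixOrder in
    obtain ⟨B, hB⟩ := CStarAlgebra.nonneg_iff_eq_star_mul_self.1 h.nonneg
    exact ⟨B, hB⟩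
  have hdet : (X.transpose * X).det = B.det ^ 2 := by
    rw [hB, Matrix.det_mul, Matrix.det_transpose, sq]
  obtain ⟨a, ha0, ha⟩ := exists_int_ne_zero_mulVec_le hr B (fun h => hX (by rw [hdet, h]; simp))
  refine ⟨a, ha0, ?_⟩
  rwa [dotProduct_mulVec_self, hB, ← dotProduct_mulVec_self, ← hB, hdet]

open Matrix

variable {d : ℕ}

/-- The integer matrices commuting with `G` whose rows and columns sum to zero: the ideal of the
centralizer ring of `G` that acts on the zero-sum lattice. -/
def zeroSumCentralizer (G : Subgroup (Equiv.Perm (Fin d))) :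
    Submodule ℤ (Matrix (Fin d) (Fin d) ℤ) where
  carrier := {A | A *ᵥ 1 = 0 ∧ 1 ᵥ* A = 0 ∧ ∀ σ ∈ G, A.submatrix σ σ = A}
  zero_mem' := by simp
  add_mem' := by
    rintro A B ⟨hA, hA', hAG⟩ ⟨hB, hB', hBG⟩
    refine ⟨by simp [add_mulVec, hA, hB], by simp [vecMul_add, hA', hB'], fun σ hσ => ?_⟩
    rw [submatrix_add, Pi.add_apply, Pi.add_apply, hAG σ hσ, hBG σ hσ]
  smul_mem' := by
    rintro n A ⟨hA, hA', hAG⟩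
    refine ⟨by rw [smul_mulVec, hA, smul_zero], by rw [vecMul_smul, hA', smul_zero], fun σ hσ => ?_⟩
    rw [submatrix_smul, Pi.smul_apply, Pi.smul_apply, hAG σ hσ]

/-- `d` times the orthogonal projection onto the zero-sum space. -/
def centering (d : ℕ) (R : Type*) [CommRing R] : Matrix (Fin d) (Fin d) R :=
  Matrix.of fun i j => (if i = j then (d : R) else 0) - 1

section centering

variable {R : Type*} [CommRing R]

theorem centering_mulVec (x : Fin d → R) (i : Fin d) :
    (centering d R *ᵥ x) i = d * x i - ∑ j, x j := by
  simp [centering, mulVec, dotProduct, sub_mul, Finset.sum_sub_distrib]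

theorem sum_centering_mulVec (x : Fin d → R) : ∑ i, (centering d R *ᵥ x) i = 0 := by
  simp [centering_mulVec, Finset.mul_sum]

theorem centering_mulVec_of_sum_eq_zero {x : Fin d → R} (hx : ∑ i, x i = 0) :
    centering d R *ᵥ x = (d : R) • x := by
  ext i
  simp [centering_mulVec, hx]

theorem centering_mulVec_comp (x : Fin d → R) (σ : Equiv.Perm (Fin d)) :
    centering d R *ᵥ (x ∘ σ) = (centering d R *ᵥ x) ∘ σ := by
  ext i
  simp [centering_mulVec, Equiv.sum_comp σ x]

theorem centering_transpose : (centering d R)ᵀ = centering d R := by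
  ext i j
  simp [centering, eq_comm]

theorem centering_submatrix (σ : Equiv.Perm (Fin d)) :
    (centering d R).submatrix σ σ = centering d R := by
  ext i j
  simp [centering]

end centering

variable {G : Subgroup (Equiv.Perm (Fin d))}

theorem centering_mem : centering d ℤ ∈ zeroSumCentralizer G := by
  refine ⟨?_, ?_, fun σ _ => centering_submatrix σ⟩
  · ext i
    simp [centering_mulVec]
  · rw [← mulVec_transpose, centering_transpose]
    ext i
    simp [centering_mulVec]

theorem mul_mem_zeroSumCentralizer {A B : Matrix (Fin d) (Fin d) ℤ}
    (hA : A ∈ zeroSumCentralizer G) (hB : B ∈ zeroSumCentralizer G) :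
    A * B ∈ zeroSumCentralizer G := by
  refine ⟨?_, ?_, fun σ hσ => ?_⟩
  · rw [← mulVec_mulVec, hB.1, mulVec_zero]
  · rw [← vecMul_vecMul, hA.2.1, zero_vecMul]
  · rw [← submatrix_mul_equiv A B σ σ σ, hA.2.2 σ hσ, hB.2.2 σ hσ]

theorem centering_mul {A : Matrix (Fin d) (Fin d) ℤ} (hA : A ∈ zeroSumCentralizer G) :
    centering d ℤ * A = (d : ℤ) • A := by
  ext i j
  have h := congrFun hA.2.1 j
  simp only [vecMul, dotProduct, Pi.one_apply, one_mul, Pi.zero_apply] at h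
  have h2 := centering_mulVec (fun k => A k j) i
  rw [h] at h2
  simpa [Matrix.mul_apply, mulVec, dotProduct] using h2

theorem mul_centering {A : Matrix (Fin d) (Fin d) ℤ} (hA : A ∈ zeroSumCentralizer G) :
    A * centering d ℤ = (d : ℤ) • A := by
  ext i j
  have h := congrFun hA.1 i
  simp only [mulVec, dotProduct, Pi.one_apply, mul_one, Pi.zero_apply] at h
  have h2 := centering_mulVec (fun k => A i k) j
  rw [h, ← vecMul_transpose, centering_transpose] at h2
  simpa [Matrix.mul_apply, vecMul, dotProduct] using h2

theorem sum_mulVec_eq_zero {A : Matrix (Fin d) (Fin d) ℤ} (hA : A ∈ zeroSumCentralizer G)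
    (x : Fin d → ℤ) : ∑ i, (A *ᵥ x) i = 0 := by
  have : (1 : Fin d → ℤ) ⬝ᵥ (A *ᵥ x) = 0 := by rw [dotProduct_mulVec, hA.2.1, zero_dotProduct]
  simpa [dotProduct] using this

theorem mulVec_comp_of_submatrix_eq {R : Type*} [CommRing R] {A : Matrix (Fin d) (Fin d) R}
    {σ : Equiv.Perm (Fin d)} (hA : A.submatrix σ σ = A) (x : Fin d → R) :
    A *ᵥ (x ∘ σ) = (A *ᵥ x) ∘ σ := by
  conv_lhs => rw [← hA]
  rw [submatrix_mulVec_equiv]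
  congr 2
  ext i
  simp

/-- Irreducibility over `ℚ`: nonzero elements act injectively on the zero-sum lattice. -/
theorem mulVec_ne_zero_of_mem (hQI : IsQIGroup G) {A : Matrix (Fin d) (Fin d) ℤ}
    (hA : A ∈ zeroSumCentralizer G) (hA0 : A ≠ 0) {y : Fin d → ℤ} (hy : ∑ i, y i = 0)
    (hy0 : y ≠ 0) : A *ᵥ y ≠ 0 := by
  intro hAy
  set A' : Matrix (Fin d) (Fin d) ℚ := A.map (Int.castRingHom ℚ) with hA'
  have hcast : ∀ v : Fin d → ℤ, A' *ᵥ (Int.castRingHom ℚ ∘ v) = Int.castRingHom ℚ ∘ (A *ᵥ v) := by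
    intro v
    ext i
    exact (RingHom.map_mulVec (Int.castRingHom ℚ) A v i).symm
  have hG : ∀ σ ∈ G, A'.submatrix σ σ = A' := fun σ hσ => by
    rw [hA', submatrix_map, hA.2.2 σ hσ]
  let s : (Fin d → ℚ) →ₗ[ℚ] ℚ := ∑ i, LinearMap.proj i
  have hs : ∀ x, s x = ∑ i, x i := fun x => by simp [s]
  rcases hQI.2 (LinearMap.ker s ⊓ LinearMap.ker (Matrix.toLin' A'))
    (fun x hx => by rw [← hs]; exact hx.1)
    (fun σ hσ x hx => by
      refine ⟨?_, ?_⟩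
      · have h1 : ∑ i, x i = 0 := (hs x).symm.trans hx.1
        change s _ = 0
        rw [hs, ← h1]
        exact Equiv.sum_comp σ x
      · have h2 : A' *ᵥ x = 0 := hx.2
        change A' *ᵥ (x ∘ σ) = 0
        rw [mulVec_comp_of_submatrix_eq (hG σ hσ), h2]
        rfl) with h | h
  · have hmem : Int.castRingHom ℚ ∘ y ∈ LinearMap.ker s ⊓ LinearMap.ker (Matrix.toLin' A') := by
      refine ⟨?_, ?_⟩
      · change s _ = 0
        rw [hs]
        simp only [Function.comp_apply, ← map_sum, hy, map_zero]
      · change A' *ᵥ _ = 0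
        rw [hcast, hAy]
        ext
        simp
    rw [h, Submodule.mem_bot] at hmem
    apply hy0
    ext i
    simpa using congrFun hmem i
  · have key : A * centering d ℤ = 0 := by
      ext i j
      have h1 : Int.castRingHom ℚ ∘ (centering d ℤ *ᵥ Pi.single j 1) ∈
          ((LinearMap.ker s ⊓ LinearMap.ker (Matrix.toLin' A') : Submodule ℚ (Fin d → ℚ)) :
            Set (Fin d → ℚ)) := by
        rw [h]
        simp only [Set.mem_ofPred_eq, Function.comp_apply, ← map_sum, sum_centering_mulVec,
          map_zero]
      have h2 : A' *ᵥ (Int.castRingHom ℚ ∘ (centering d ℤ *ᵥ Pi.single j 1)) = 0 := h1.2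
      rw [hcast, mulVec_mulVec] at h2
      simpa using congrFun h2 i
    rw [mul_centering hA] at key
    have hd : (d : ℤ) ≠ 0 := by
      rintro h0
      obtain rfl : d = 0 := by exact_mod_cast h0
      exact hA0 (by ext i; exact i.elim0)
    exact hA0 ((smul_eq_zero.1 key).resolve_left hd)

theorem eq_zero_of_mul_eq_zero (hQI : IsQIGroup G) {A S : Matrix (Fin d) (Fin d) ℤ}
    (hA : A ∈ zeroSumCentralizer G) (hS : S ∈ zeroSumCentralizer G) (hAS : A * S = 0)
    (hS0 : S ≠ 0) : A = 0 := by
  obtain ⟨j, hj⟩ : ∃ j, S *ᵥ Pi.single j 1 ≠ 0 := by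
    by_contra! h
    apply hS0
    ext i j
    simpa using congrFun (h j) i
  by_contra hA0
  exact mulVec_ne_zero_of_mem hQI hA hA0 (sum_mulVec_eq_zero hS _) hj
    (by rw [mulVec_mulVec, hAS, zero_mulVec])

/-- The entrywise cast of an integer matrix to a real one. -/
def realMat (d : ℕ) : Matrix (Fin d) (Fin d) ℤ →+* Matrix (Fin d) (Fin d) ℝ :=
  (Int.castRingHom ℝ).mapMatrix

theorem realMat_mulVec_cast (A : Matrix (Fin d) (Fin d) ℤ) (v : Fin d → ℤ) :
    realMat d A *ᵥ (fun i => (v i : ℝ)) = fun i => (((A *ᵥ v) i : ℤ) : ℝ) := by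
  ext i
  exact (RingHom.map_mulVec (Int.castRingHom ℝ) A v i).symm

theorem realMat_submatrix {A : Matrix (Fin d) (Fin d) ℤ} (hA : A ∈ zeroSumCentralizer G)
    {σ : Equiv.Perm (Fin d)} (hσ : σ ∈ G) : (realMat d A).submatrix σ σ = realMat d A := by
  conv_rhs => rw [← hA.2.2 σ hσ]
  rfl

theorem realMat_centering : realMat d (centering d ℤ) = centering d ℝ := by
  ext i j
  simp [realMat, centering]

/-- A bound for the Euclidean operator norm of a matrix. -/
theorem exists_mulVec_dotProduct_le (A : Matrix (Fin d) (Fin d) ℝ) :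
    ∃ κ : ℝ, 0 ≤ κ ∧ ∀ x, (A *ᵥ x) ⬝ᵥ (A *ᵥ x) ≤ κ * (x ⬝ᵥ x) := by
  refine ⟨∑ k, ∑ l, A k l ^ 2, by positivity, fun x => ?_⟩
  rw [dotProduct, Finset.sum_mul]
  refine Finset.sum_le_sum fun k _ => ?_
  have h := Finset.sum_mul_sq_le_sq_mul_sq Finset.univ (A k) x
  simpa [mulVec, dotProduct, sq] using h

variable (G) in
/-- A basis of the lattice `zeroSumCentralizer G`. -/
noncomputable def centralizerBasis :
    Module.Basis (Fin (Module.finrank ℤ (zeroSumCentralizer G))) ℤ (zeroSumCentralizer G) :=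
  Module.finBasis ℤ _

variable (G) in
/-- The matrix whose columns are the images of `x` under the basis of `zeroSumCentralizer G`. -/
noncomputable def actionMat (x : Fin d → ℝ) :
    Matrix (Fin d) (Fin (Module.finrank ℤ (zeroSumCentralizer G))) ℝ :=
  Matrix.of fun k i => (realMat d (centralizerBasis G i) *ᵥ x) k

variable (G) in
/-- The Gram determinant of the images of `x` under the basis of `zeroSumCentralizer G`. -/
noncomputable def gramDet (x : Fin d → ℝ) : ℝ :=
  ((actionMat G x)ᵀ * actionMat G x).det

/-- The matrix of right multiplication by `s` on `zeroSumCentralizer G`. -/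
noncomputable def rightMulMat (s : zeroSumCentralizer G) :
    Matrix (Fin (Module.finrank ℤ (zeroSumCentralizer G)))
      (Fin (Module.finrank ℤ (zeroSumCentralizer G))) ℤ :=
  Matrix.of fun j i => (centralizerBasis G).repr
    ⟨centralizerBasis G i * s, mul_mem_zeroSumCentralizer (centralizerBasis G i).2 s.2⟩ j

theorem centralizerBasis_mul (s : zeroSumCentralizer G)
    (i : Fin (Module.finrank ℤ (zeroSumCentralizer G))) :
    (centralizerBasis G i * s : Matrix (Fin d) (Fin d) ℤ) =
      ∑ j, rightMulMat s j i • (centralizerBasis G j : Matrix (Fin d) (Fin d) ℤ) := by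
  have h := congrArg Subtype.val ((centralizerBasis G).sum_repr
    ⟨centralizerBasis G i * s, mul_mem_zeroSumCentralizer (centralizerBasis G i).2 s.2⟩)
  rw [Submodule.coe_sum] at h
  exact h.symm

theorem actionMat_mulVec (x : Fin d → ℝ)
    (a : Fin (Module.finrank ℤ (zeroSumCentralizer G)) → ℝ) :
    actionMat G x *ᵥ a = (∑ i, a i • realMat d (centralizerBasis G i)) *ᵥ x := by
  ext k
  simp only [actionMat, sum_mulVec, smul_mulVec, Finset.sum_apply, Pi.smul_apply, smul_eq_mul]
  simp [mulVec, dotProduct, mul_comm]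

theorem actionMat_mulVec_cast (x : Fin d → ℝ)
    (a : Fin (Module.finrank ℤ (zeroSumCentralizer G)) → ℤ) :
    actionMat G x *ᵥ (fun i => (a i : ℝ)) =
      realMat d (∑ i, a i • centralizerBasis G i : zeroSumCentralizer G) *ᵥ x := by
  rw [actionMat_mulVec]
  congr 1
  rw [Submodule.coe_sum, map_sum]
  refine Finset.sum_congr rfl fun i _ => ?_
  rw [Submodule.coe_smul, map_zsmul, Int.cast_smul_eq_zsmul]

theorem actionMat_realMat_mulVec (s : zeroSumCentralizer G) (x : Fin d → ℝ) :
    actionMat G (realMat d s *ᵥ x) =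
      actionMat G x * (rightMulMat s).map (Int.castRingHom ℝ) := by
  ext k i
  have h : (actionMat G x * (rightMulMat s).map (Int.castRingHom ℝ)) k i =
      (actionMat G x *ᵥ fun j => (rightMulMat s j i : ℝ)) k := by
    simp [Matrix.mul_apply, mulVec, dotProduct]
  rw [h, actionMat_mulVec_cast]
  simp only [actionMat, Matrix.of_apply]
  rw [mulVec_mulVec, ← map_mul, centralizerBasis_mul, Submodule.coe_sum]
  rfl

theorem gramDet_realMat_mulVec (s : zeroSumCentralizer G) (x : Fin d → ℝ) :
    gramDet G (realMat d s *ᵥ x) = ((rightMulMat s).det : ℝ) ^ 2 * gramDet G x := by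
  have h : ((rightMulMat s).map (Int.castRingHom ℝ)).det = ((rightMulMat s).det : ℝ) :=
    ((Int.castRingHom ℝ).map_det (rightMulMat s)).symm
  rw [gramDet, actionMat_realMat_mulVec, transpose_mul, Matrix.mul_assoc,
    ← Matrix.mul_assoc (actionMat G x)ᵀ, det_mul, det_mul, det_transpose, h, gramDet]
  ring

theorem gramDet_smul (c : ℝ) (x : Fin d → ℝ) :
    gramDet G (c • x) = (c ^ 2) ^ Module.finrank ℤ (zeroSumCentralizer G) * gramDet G x := by
  have h : actionMat G (c • x) = c • actionMat G x := by
    ext k i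
    simp [actionMat, mulVec_smul]
  rw [gramDet, h, transpose_smul, Matrix.smul_mul, Matrix.mul_smul, smul_smul, det_smul,
    Fintype.card_fin, gramDet, sq]

theorem continuous_gramDet : Continuous (gramDet G) := by
  unfold gramDet actionMat
  fun_prop

theorem gramDet_nonneg (x : Fin d → ℝ) : 0 ≤ gramDet G x :=
  (posSemidef_conjTranspose_mul_self (actionMat G x)).det_nonneg

theorem exists_gramDet_le : ∃ C : ℝ, 0 ≤ C ∧ ∀ x, gramDet G x ≤
    C * (x ⬝ᵥ x) ^ Module.finrank ℤ (zeroSumCentralizer G) := by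
  choose κ hκ0 hκ using fun i => exists_mulVec_dotProduct_le (realMat d (centralizerBasis G i))
  refine ⟨(Module.finrank ℤ (zeroSumCentralizer G)).factorial *
    (∑ i, κ i) ^ Module.finrank ℤ (zeroSumCentralizer G), ?_, fun x => ?_⟩
  · have := Finset.sum_nonneg fun i (_ : i ∈ Finset.univ) => hκ0 i
    positivity
  have hx : 0 ≤ x ⬝ᵥ x := Finset.sum_nonneg fun i _ => mul_self_nonneg _
  have hle : ∀ i, (realMat d (centralizerBasis G i) *ᵥ x) ⬝ᵥ
      (realMat d (centralizerBasis G i) *ᵥ x) ≤ (∑ i, κ i) * (x ⬝ᵥ x) := fun i =>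
    (hκ i x).trans (mul_le_mul_of_nonneg_right
      (Finset.single_le_sum (fun i _ => hκ0 i) (Finset.mem_univ i)) hx)
  have h := det_le (A := (actionMat G x)ᵀ * actionMat G x) (abv := AbsoluteValue.abs)
    (x := (∑ i, κ i) * (x ⬝ᵥ x)) (fun i j => by
      set u := realMat d (centralizerBasis G i) *ᵥ x
      set v := realMat d (centralizerBasis G j) *ᵥ x
      have huv : ((actionMat G x)ᵀ * actionMat G x) i j = u ⬝ᵥ v := rfl
      rw [huv, AbsoluteValue.abs_apply, abs_le]
      have h1 : 0 ≤ (u + v) ⬝ᵥ (u + v) := Finset.sum_nonneg fun i _ => mul_self_nonneg _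
      have h2 : 0 ≤ (u - v) ⬝ᵥ (u - v) := Finset.sum_nonneg fun i _ => mul_self_nonneg _
      simp only [add_dotProduct, dotProduct_add, sub_dotProduct, dotProduct_sub,
        dotProduct_comm v u] at h1 h2
      constructor <;> linarith [hle i, hle j])
  refine (le_abs_self _).trans (h.trans_eq ?_)
  rw [nsmul_eq_mul, Fintype.card_fin, mul_pow, mul_assoc]

/-- The determinant of right multiplication by `s` annihilates the cokernel. -/
theorem exists_mul_eq_det_smul_centering (s : zeroSumCentralizer G) :
    ∃ t ∈ zeroSumCentralizer G, t * s = (rightMulMat s).det • centering d ℤ := by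
  set b := centralizerBasis G with hb
  set c := b.repr ⟨centering d ℤ, centering_mem⟩ with hc
  have hsum : ∑ j, c j • (b j : Matrix (Fin d) (Fin d) ℤ) = centering d ℤ := by
    have h := congrArg Subtype.val (b.sum_repr ⟨centering d ℤ, centering_mem⟩)
    rw [Submodule.coe_sum] at h
    exact h
  set a := (rightMulMat s).adjugate *ᵥ c with ha
  have hρa : rightMulMat s *ᵥ a = (rightMulMat s).det • ⇑c := by
    rw [ha, mulVec_mulVec, mul_adjugate, smul_mulVec, one_mulVec]
  refine ⟨∑ i, a i • (b i : Matrix (Fin d) (Fin d) ℤ),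
    Submodule.sum_mem _ fun i _ => Submodule.smul_mem _ _ (b i).2, ?_⟩
  calc (∑ i, a i • (b i : Matrix (Fin d) (Fin d) ℤ)) * s
      = ∑ i, a i • ∑ j, rightMulMat s j i • (b j : Matrix (Fin d) (Fin d) ℤ) := by
        rw [Finset.sum_mul]
        refine Finset.sum_congr rfl fun i _ => ?_
        rw [smul_mul_assoc, hb, centralizerBasis_mul]
    _ = ∑ j, (rightMulMat s *ᵥ a) j • (b j : Matrix (Fin d) (Fin d) ℤ) := by
        simp_rw [Finset.smul_sum, smul_smul]
        rw [Finset.sum_comm]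
        refine Finset.sum_congr rfl fun j _ => ?_
        rw [← Finset.sum_smul, mulVec, dotProduct]
        simp_rw [mul_comm]
    _ = (rightMulMat s).det • centering d ℤ := by
        rw [hρa, ← hsum, Finset.smul_sum]
        simp [mul_smul]

/-- The Gram determinant of a nonzero lattice vector does not vanish. -/
theorem gramDet_cast_ne_zero (hQI : IsQIGroup G) {y : Fin d → ℤ} (hy : ∑ i, y i = 0)
    (hy0 : y ≠ 0) : gramDet G (fun i => (y i : ℝ)) ≠ 0 := by
  set b := centralizerBasis G with hb
  set X : Matrix (Fin d) (Fin (Module.finrank ℤ (zeroSumCentralizer G))) ℤ :=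
    Matrix.of fun k i => ((b i : Matrix (Fin d) (Fin d) ℤ) *ᵥ y) k with hX
  have hXa : ∀ a, X *ᵥ a = ((∑ i, a i • b i : zeroSumCentralizer G) :
      Matrix (Fin d) (Fin d) ℤ) *ᵥ y := by
    intro a
    ext k
    rw [Submodule.coe_sum]
    simp only [Submodule.coe_smul, sum_mulVec, smul_mulVec, Finset.sum_apply, Pi.smul_apply,
      smul_eq_mul]
    simp [hX, mulVec, dotProduct, mul_comm]
  have hcast : actionMat G (fun i => (y i : ℝ)) = X.map (Int.castRingHom ℝ) := by
    ext k i
    simp [actionMat, realMat_mulVec_cast, hX, hb]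
  have hdet : gramDet G (fun i => (y i : ℝ)) = ((Xᵀ * X).det : ℝ) := by
    rw [gramDet, hcast, ← transpose_map, ← Matrix.map_mul]
    exact ((Int.castRingHom ℝ).map_det _).symm
  rw [hdet, Int.cast_ne_zero, Ne, ← exists_mulVec_eq_zero_iff]
  rintro ⟨a, ha0, ha⟩
  have h0 : X *ᵥ a = 0 := by
    rw [← dotProduct_self_eq_zero, dotProduct_mulVec, ← mulVec_transpose, mulVec_mulVec, ha,
      zero_dotProduct]
  rw [hXa] at h0
  refine mulVec_ne_zero_of_mem hQI (∑ i, a i • b i : zeroSumCentralizer G).2 ?_ hy hy0 h0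
  intro h
  apply ha0
  ext i
  exact Fintype.linearIndependent_iff.1 b.linearIndependent a (Subtype.ext h) i

theorem dotProduct_self_nonneg_of_real (x : Fin d → ℝ) : 0 ≤ x ⬝ᵥ x :=
  Finset.sum_nonneg fun i _ => mul_self_nonneg (x i)

/-- Every nonzero vector of the zero-sum lattice is moved to a balanced one by an element of
`zeroSumCentralizer G` of bounded norm. -/
theorem exists_balancing (hQI : IsQIGroup G) :
    ∃ N : ℕ, ∀ y : Fin d → ℤ, ∑ i, y i = 0 → y ≠ 0 → ∃ s : zeroSumCentralizer G,
      (rightMulMat s).det ≠ 0 ∧ (rightMulMat s).det.natAbs ≤ N ∧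
      let x := realMat d s *ᵥ (fun i => (y i : ℝ))
      (x ⬝ᵥ x) ^ Module.finrank ℤ (zeroSumCentralizer G) ≤
        (Module.finrank ℤ (zeroSumCentralizer G) : ℝ) ^
          Module.finrank ℤ (zeroSumCentralizer G) * gramDet G x := by
  set r := Module.finrank ℤ (zeroSumCentralizer G) with hr
  obtain ⟨C, hC0, hC⟩ := exists_gramDet_le (G := G)
  refine ⟨⌈C * (r : ℝ) ^ r⌉₊, fun y hy hy0 => ?_⟩
  have hD0 := gramDet_cast_ne_zero hQI hy hy0
  have hr0 : 0 < r := by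
    rw [hr, Module.finrank_pos_iff_of_free]
    refine ⟨⟨⟨centering d ℤ, centering_mem⟩, 0, fun h => ?_⟩⟩
    have h1 : centering d ℤ = 0 := congrArg Subtype.val h
    have h2 := centering_mulVec_of_sum_eq_zero hy
    rw [h1, zero_mulVec, eq_comm, smul_eq_zero] at h2
    rcases h2 with h2 | h2
    · obtain rfl : d = 0 := by exact_mod_cast h2
      exact hy0 (Subsingleton.elim _ _)
    · exact hy0 h2
  obtain ⟨a, ha0, ha⟩ := exists_int_ne_zero_gram_le hr0 (actionMat G fun i => (y i : ℝ)) hD0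
  rw [actionMat_mulVec_cast] at ha
  set s : zeroSumCentralizer G := ∑ i, a i • centralizerBasis G i
  have hs0 : (s : Matrix (Fin d) (Fin d) ℤ) ≠ 0 := fun h => ha0 <| by
    ext i
    exact Fintype.linearIndependent_iff.1 (centralizerBasis G).linearIndependent a
      (Subtype.ext h) i
  have hgram := gramDet_realMat_mulVec s (fun i => (y i : ℝ))
  have hx0 : gramDet G (realMat d s *ᵥ (fun i => (y i : ℝ))) ≠ 0 := by
    rw [realMat_mulVec_cast]
    exact gramDet_cast_ne_zero hQI (sum_mulVec_eq_zero s.2 y)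
      (mulVec_ne_zero_of_mem hQI s.2 hs0 hy hy0)
  have hdet0 : (rightMulMat s).det ≠ 0 := by
    intro h
    rw [hgram, h] at hx0
    simp at hx0
  have hD : 0 < gramDet G (fun i => (y i : ℝ)) := (gramDet_nonneg _).lt_of_ne' hD0
  have hone : (1 : ℝ) ≤ ((rightMulMat s).det.natAbs : ℝ) := by
    exact_mod_cast Int.natAbs_pos.2 hdet0
  have habs : ((rightMulMat s).det : ℝ) ^ 2 = ((rightMulMat s).det.natAbs : ℝ) ^ 2 := by
    rw [Nat.cast_natAbs, Int.cast_abs, sq_abs]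
  have ha' : ((realMat d s *ᵥ fun i => (y i : ℝ)) ⬝ᵥ (realMat d s *ᵥ fun i => (y i : ℝ))) ^ r ≤
    (r : ℝ) ^ r * gramDet G (fun i => (y i : ℝ)) := ha
  refine ⟨s, hdet0, ?_, ha'.trans ?_⟩
  · have h1 := (hC (realMat d s *ᵥ (fun i => (y i : ℝ)))).trans (mul_le_mul_of_nonneg_left ha' hC0)
    rw [hgram, ← mul_assoc] at h1
    have h2 := le_of_mul_le_mul_right h1 hD
    have h3 : ((rightMulMat s).det.natAbs : ℝ) ≤ C * (r : ℝ) ^ r := by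
      rw [habs] at h2
      nlinarith
    exact_mod_cast h3.trans (Nat.le_ceil _)
  · rw [hgram, habs]
    have : (1 : ℝ) ≤ ((rightMulMat s).det.natAbs : ℝ) ^ 2 := one_le_pow₀ hone
    gcongr
    nlinarith

/-- Elements congruent modulo a multiple of their norm are right associates. -/
theorem exists_eq_mul_one_add (hQI : IsQIGroup G) {s a : zeroSumCentralizer G} (k : ℤ) :
    ∃ h ∈ zeroSumCentralizer G,
      (s + ((rightMulMat s).det * d * k) • a : Matrix (Fin d) (Fin d) ℤ) = s * (1 + h) := by
  obtain ⟨t, ht, hts⟩ := exists_mul_eq_det_smul_centering s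
  set m := (rightMulMat s).det
  have hst : (s : Matrix (Fin d) (Fin d) ℤ) * t = m • centering d ℤ := by
    by_cases hs0 : (s : Matrix (Fin d) (Fin d) ℤ) = 0
    · rw [← hts, hs0, zero_mul, mul_zero]
    rw [← sub_eq_zero]
    refine eq_zero_of_mul_eq_zero hQI (sub_mem (mul_mem_zeroSumCentralizer s.2 ht)
      (Submodule.smul_mem _ _ centering_mem)) s.2 ?_ hs0
    rw [sub_mul, mul_assoc, hts, mul_smul_comm, smul_mul_assoc, centering_mul s.2,
      mul_centering s.2, sub_self]
  refine ⟨k • (t * a), Submodule.smul_mem _ _ (mul_mem_zeroSumCentralizer ht a.2), ?_⟩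
  rw [mul_add, mul_one, mul_smul_comm, ← mul_assoc, hst, smul_mul_assoc, centering_mul a.2,
    smul_smul, smul_smul]
  congr 2
  ring

theorem exists_unit_of_congr (hQI : IsQIGroup G) {s s' a : zeroSumCentralizer G} {k : ℤ}
    (hk : (rightMulMat s).det * d ∣ k) (hk' : (rightMulMat s').det * d ∣ k)
    (hs0 : (s : Matrix (Fin d) (Fin d) ℤ) ≠ 0) (h : s' = s + k • a) :
    ∃ u u' : Matrix (Fin d) (Fin d) ℤ, u - 1 ∈ zeroSumCentralizer G ∧ u * u' = 1 ∧
      u' * u = 1 ∧ (s' : Matrix (Fin d) (Fin d) ℤ) = s * u := by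
  obtain ⟨n, rfl⟩ := hk
  obtain ⟨n', hn'⟩ := hk'
  obtain ⟨v, hv, hsv⟩ := exists_eq_mul_one_add hQI (a := a) n
  obtain ⟨v', hv', hsv'⟩ := exists_eq_mul_one_add hQI (a := -a) n'
  have h1 : (s' : Matrix (Fin d) (Fin d) ℤ) = s * (1 + v) := by
    rw [← hsv, h]
    rfl
  have h2 : (s : Matrix (Fin d) (Fin d) ℤ) = s' * (1 + v') := by
    rw [← hsv', ← hn', h]
    simp
  have h3 : (1 + v) * (1 + v') = 1 := by
    have h4 : (1 + v) * (1 + v') - 1 = v + v' + v * v' := by noncomm_ring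
    have h5 : (1 + v) * (1 + v') - 1 ∈ zeroSumCentralizer G := by
      rw [h4]
      exact add_mem (add_mem hv hv') (mul_mem_zeroSumCentralizer hv hv')
    by_contra h6
    have h7 : (s : Matrix (Fin d) (Fin d) ℤ) * ((1 + v) * (1 + v') - 1) = 0 := by
      rw [mul_sub, ← mul_assoc, ← h1, ← h2, mul_one, sub_self]
    exact hs0 (eq_zero_of_mul_eq_zero hQI s.2 h5 h7 (sub_ne_zero.2 h6))
  exact ⟨1 + v, 1 + v', by simpa using hv, h3, mul_eq_one_comm.1 h3, h1⟩

/-- Every nonzero vector of the zero-sum lattice is balanced by a unit of the centralizer. -/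
theorem exists_balancing_unit (hQI : IsQIGroup G) :
    ∃ C : ℝ, 0 ≤ C ∧ ∀ y : Fin d → ℤ, ∑ i, y i = 0 → y ≠ 0 →
      ∃ u u' : Matrix (Fin d) (Fin d) ℤ, u - 1 ∈ zeroSumCentralizer G ∧ u * u' = 1 ∧
        u' * u = 1 ∧
        let x := realMat d u *ᵥ (fun i => (y i : ℝ))
        (x ⬝ᵥ x) ^ Module.finrank ℤ (zeroSumCentralizer G) ≤ C * gramDet G x := by
  set r := Module.finrank ℤ (zeroSumCentralizer G) with hr
  obtain ⟨N, hN⟩ := exists_balancing hQI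
  choose! S hS0 hSN hS using hN
  rcases Nat.eq_zero_or_pos d with rfl | hd
  · exact ⟨0, le_rfl, fun y _ hy0 => (hy0 (Subsingleton.elim _ _)).elim⟩
  set K : ℕ := N.factorial * d with hK
  have : NeZero K := ⟨by positivity⟩
  have hdvd : ∀ y : Fin d → ℤ, ∑ i, y i = 0 → y ≠ 0 → (rightMulMat (S y)).det * d ∣ (K : ℤ) := by
    intro y hy hy0
    rw [hK, Nat.cast_mul]
    refine mul_dvd_mul_right ?_ _
    rw [Int.dvd_natCast]
    exact Nat.dvd_factorial (Int.natAbs_pos.2 (hS0 y hy hy0)) (hSN y hy hy0)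
  let cls : (Fin d → ℤ) → (Fin r → ZMod K) := fun y i =>
    ((centralizerBasis G).repr (S y) i : ZMod K)
  have hSne : ∀ y : Fin d → ℤ, ∑ i, y i = 0 → y ≠ 0 →
      (S y : Matrix (Fin d) (Fin d) ℤ) ≠ 0 := by
    intro y hy hy0 h
    obtain ⟨t, ht, hts⟩ := exists_mul_eq_det_smul_centering (S y)
    rw [h, mul_zero, eq_comm, smul_eq_zero] at hts
    rcases hts with h1 | h1
    · exact hS0 y hy hy0 h1
    · have h2 := centering_mulVec_of_sum_eq_zero hy
      rw [h1, zero_mulVec, eq_comm, smul_eq_zero] at h2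
      rcases h2 with h2 | h2
      · have : d = 0 := by exact_mod_cast h2
        omega
      · exact hy0 h2
  have hcls : ∀ c : Fin r → ZMod K, ∃ C : ℝ, ∀ y : Fin d → ℤ, ∑ i, y i = 0 → y ≠ 0 → cls y = c →
      ∃ u u' : Matrix (Fin d) (Fin d) ℤ, u - 1 ∈ zeroSumCentralizer G ∧ u * u' = 1 ∧
        u' * u = 1 ∧
        let x := realMat d u *ᵥ (fun i => (y i : ℝ))
        (x ⬝ᵥ x) ^ r ≤ C * gramDet G x := by
    intro c
    by_cases hc : ∃ y₀ : Fin d → ℤ, ∑ i, y₀ i = 0 ∧ y₀ ≠ 0 ∧ cls y₀ = c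
    swap
    · exact ⟨0, fun y hy hy0 hyc => (hc ⟨y, hy, hy0, hyc⟩).elim⟩
    obtain ⟨y₀, hy₀, hy₀0, hy₀c⟩ := hc
    set s := S y₀
    obtain ⟨t, ht, hts⟩ := exists_mul_eq_det_smul_centering s
    set m := (rightMulMat s).det with hm
    obtain ⟨κ, hκ0, hκ⟩ := exists_mulVec_dotProduct_le (realMat d t)
    refine ⟨κ ^ r * ((r : ℝ) ^ r * (m : ℝ) ^ 2), fun y hy hy0 hyc => ?_⟩
    obtain ⟨a, ha⟩ : ∃ a : zeroSumCentralizer G, S y = s + (K : ℤ) • a := by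
      have h1 : ∀ i, (K : ℤ) ∣ (centralizerBasis G).repr (S y) i -
          (centralizerBasis G).repr s i := by
        intro i
        have h2 := congrFun (hyc.trans hy₀c.symm) i
        rw [← ZMod.intCast_zmod_eq_zero_iff_dvd, Int.cast_sub, sub_eq_zero]
        exact h2
      choose n hn using h1
      refine ⟨∑ i, n i • centralizerBasis G i, ?_⟩
      rw [Finset.smul_sum, ← sub_eq_iff_eq_add', ← (centralizerBasis G).sum_repr (S y - s)]
      refine Finset.sum_congr rfl fun i _ => ?_
      rw [smul_smul, ← hn]
      simp
    obtain ⟨u, u', hu, huu', hu'u, hsu⟩ := exists_unit_of_congr hQI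
      (hdvd y₀ hy₀ hy₀0) (hdvd y hy hy0) (hSne y₀ hy₀ hy₀0) ha
    refine ⟨u, u', hu, huu', hu'u, ?_⟩
    intro x
    have hbal := hS y hy hy0
    have hxs : realMat d (S y) *ᵥ (fun i => (y i : ℝ)) = realMat d s *ᵥ x := by
      rw [hsu, map_mul, ← mulVec_mulVec]
    simp only [hxs, gramDet_realMat_mulVec] at hbal
    have hxsum : ∑ i, x i = 0 := by
      have h1 : ∑ i, (u *ᵥ y) i = 0 := by
        have h2 := sum_mulVec_eq_zero hu y
        rw [sub_mulVec, one_mulVec] at h2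
        simpa [hy] using h2
      simp only [x, realMat_mulVec_cast]
      exact_mod_cast h1
    have hx : x ⬝ᵥ x ≤ κ * ((realMat d s *ᵥ x) ⬝ᵥ (realMat d s *ᵥ x)) := by
      refine le_trans ?_ (hκ _)
      rw [mulVec_mulVec, ← map_mul, hts, map_zsmul, realMat_centering, smul_mulVec,
        centering_mulVec_of_sum_eq_zero hxsum, ← Int.cast_smul_eq_zsmul ℝ, smul_smul,
        smul_dotProduct, dotProduct_smul, smul_smul, smul_eq_mul]
      have h1 : (1 : ℝ) ≤ ((m * d) * (m * d) : ℤ) := by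
        have : m * d ≠ 0 := mul_ne_zero (hS0 y₀ hy₀ hy₀0) (by exact_mod_cast hd.ne')
        exact_mod_cast Int.add_one_le_iff.2 (mul_self_pos.2 this)
      push_cast at h1
      exact le_mul_of_one_le_left (dotProduct_self_nonneg_of_real x) h1
    calc (x ⬝ᵥ x) ^ r ≤ (κ * ((realMat d s *ᵥ x) ⬝ᵥ (realMat d s *ᵥ x))) ^ r :=
          pow_le_pow_left₀ (dotProduct_self_nonneg_of_real x) hx r
      _ = κ ^ r * ((realMat d s *ᵥ x) ⬝ᵥ (realMat d s *ᵥ x)) ^ r := mul_pow _ _ _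
      _ ≤ κ ^ r * ((r : ℝ) ^ r * ((m : ℝ) ^ 2 * gramDet G x)) := by gcongr
      _ = _ := by ring
  choose C hC using hcls
  obtain ⟨M, hM⟩ := (Finset.univ.image C).exists_le
  refine ⟨max M 0, le_max_right _ _, fun y hy hy0 => ?_⟩
  obtain ⟨u, u', hu, huu', hu'u, hx⟩ := hC (cls y) y hy hy0 rfl
  refine ⟨u, u', hu, huu', hu'u, hx.trans ?_⟩
  refine mul_le_mul_of_nonneg_right ?_ (gramDet_nonneg _)
  exact (hM _ (Finset.mem_image_of_mem C (Finset.mem_univ _))).trans (le_max_left _ _)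

/-- A zero-sum vector with nonvanishing Gram determinant is not contained in a half-space together
with its orbit. -/
theorem exists_dotProduct_pos (hG : IsTransitivePerm G) {x v : Fin d → ℝ}
    (hx : gramDet G x ≠ 0) (hv : ∑ i, v i = 0) (hv0 : v ≠ 0) :
    ∃ σ ∈ G, 0 < (x ∘ σ) ⬝ᵥ v := by
  classical
  by_contra! hneg
  have hzero : ∀ σ ∈ G, (x ∘ σ) ⬝ᵥ v = 0 := by
    have hsum : ∑ σ : G, (x ∘ (σ : Equiv.Perm (Fin d))) ⬝ᵥ v = 0 := by
      simp only [dotProduct, Function.comp_apply]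
      rw [Finset.sum_comm]
      simp_rw [← Finset.sum_mul]
      have hconst : ∀ i j, ∑ σ : G, x ((σ : Equiv.Perm (Fin d)) i) =
          ∑ σ : G, x ((σ : Equiv.Perm (Fin d)) j) := by
        intro i j
        obtain ⟨τ, hτ, rfl⟩ := hG i j
        exact (Equiv.sum_comp (Equiv.mulRight (⟨τ, hτ⟩ : G))
          (fun σ : G => x ((σ : Equiv.Perm (Fin d)) i))).symm
      rcases isEmpty_or_nonempty (Fin d) with h | ⟨⟨i⟩⟩
      · simp
      · rw [Finset.sum_congr rfl fun j _ => by rw [hconst j i], ← Finset.mul_sum, hv, mul_zero]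
    have h := (Finset.sum_eq_zero_iff_of_nonpos fun σ _ => hneg σ.1 σ.2).1 hsum
    exact fun σ hσ => h ⟨σ, hσ⟩ (Finset.mem_univ _)
  let N : Fin d → Fin d → Matrix (Fin d) (Fin d) ℤ := fun i j => Matrix.of fun k l =>
    ∑ σ : G, centering d ℤ k ((σ : Equiv.Perm (Fin d)) i) *
      centering d ℤ l ((σ : Equiv.Perm (Fin d)) j)
  have hcol : ∀ i, ∑ k, centering d ℤ k i = 0 := fun i => by
    simpa [vecMul, dotProduct] using congrFun (centering_mem (G := G)).2.1 i
  have hN : ∀ i j, N i j ∈ zeroSumCentralizer G := by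
    intro i j
    refine ⟨?_, ?_, fun τ hτ => ?_⟩
    · ext k
      simp only [N, mulVec, dotProduct, Matrix.of_apply, Pi.one_apply, mul_one, Pi.zero_apply]
      rw [Finset.sum_comm]
      simp [← Finset.mul_sum, hcol]
    · ext l
      simp only [N, vecMul, dotProduct, Matrix.of_apply, Pi.one_apply, one_mul, Pi.zero_apply]
      rw [Finset.sum_comm]
      simp [← Finset.sum_mul, hcol]
    · ext k l
      simp only [N, submatrix_apply, Matrix.of_apply]
      rw [← Equiv.sum_comp (Equiv.mulLeft (⟨τ, hτ⟩ : G))]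
      refine Finset.sum_congr rfl fun σ _ => ?_
      have h1 : ∀ k i, centering d ℤ (τ k) (τ i) = centering d ℤ k i := fun k i =>
        congrFun (congrFun (centering_submatrix (R := ℤ) τ) k) i
      simp [h1]
  set A : Matrix (Fin d) (Fin d) ℝ := ∑ i, ∑ j, (v i * v j) • realMat d (N i j) with hA
  have hAentry : ∀ k l, A k l = (d : ℝ) ^ 2 * ∑ σ : G,
      v (((σ⁻¹ : G) : Equiv.Perm (Fin d)) k) * v (((σ⁻¹ : G) : Equiv.Perm (Fin d)) l) := by
    intro k l
    have h1 : ∀ (σ : G) k, ∑ i, (centering d ℤ k ((σ : Equiv.Perm (Fin d)) i) : ℝ) * v i =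
        d * v (((σ⁻¹ : G) : Equiv.Perm (Fin d)) k) := by
      intro σ k
      have hvσ : ∑ i, (v ∘ (σ : Equiv.Perm (Fin d)).symm) i = 0 := by
        rw [← hv]
        exact Equiv.sum_comp (σ : Equiv.Perm (Fin d)).symm v
      have h2 := congrFun (centering_mulVec_of_sum_eq_zero hvσ) k
      rw [← realMat_centering, mulVec, dotProduct,
        ← Equiv.sum_comp (σ : Equiv.Perm (Fin d))] at h2
      simpa [realMat] using h2
    calc A k l = ∑ i, ∑ j, ∑ σ : G, v i * v j *
          ((centering d ℤ k ((σ : Equiv.Perm (Fin d)) i) : ℝ) *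
            (centering d ℤ l ((σ : Equiv.Perm (Fin d)) j) : ℝ)) := by
          simp [hA, Matrix.sum_apply, realMat, N, Finset.mul_sum]
      _ = ∑ σ : G, ∑ i, ∑ j, v i * v j *
          ((centering d ℤ k ((σ : Equiv.Perm (Fin d)) i) : ℝ) *
            (centering d ℤ l ((σ : Equiv.Perm (Fin d)) j) : ℝ)) := by
          symm
          rw [Finset.sum_comm]
          refine Finset.sum_congr rfl fun i _ => ?_
          rw [Finset.sum_comm]
      _ = _ := by
          rw [Finset.mul_sum]
          refine Finset.sum_congr rfl fun σ _ => ?_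
          calc _ = (∑ i, (centering d ℤ k ((σ : Equiv.Perm (Fin d)) i) : ℝ) * v i) *
              (∑ j, (centering d ℤ l ((σ : Equiv.Perm (Fin d)) j) : ℝ) * v j) := by
                rw [Finset.sum_mul_sum]
                refine Finset.sum_congr rfl fun i _ => Finset.sum_congr rfl fun j _ => ?_
                ring
            _ = _ := by
                rw [h1, h1]
                ring
  have hAx : A *ᵥ x = 0 := by
    ext k
    simp only [mulVec, dotProduct, hAentry, Pi.zero_apply]
    simp_rw [mul_assoc, Finset.sum_mul, ← Finset.mul_sum]
    rw [Finset.sum_comm]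
    refine mul_eq_zero_of_right _ (Finset.sum_eq_zero fun σ _ => ?_)
    simp_rw [mul_assoc, ← Finset.mul_sum]
    have h1 := hzero σ σ.2
    rw [dotProduct, ← Equiv.sum_comp (σ : Equiv.Perm (Fin d)).symm] at h1
    refine mul_eq_zero_of_right _ ?_
    rw [← h1]
    refine Finset.sum_congr rfl fun i _ => ?_
    simp [mul_comm]
  obtain ⟨α, hα⟩ : ∃ α : Fin (Module.finrank ℤ (zeroSumCentralizer G)) → ℝ,
      ∑ p, α p • realMat d (centralizerBasis G p) = A := by
    refine ⟨fun p => ∑ i, ∑ j, (v i * v j) *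
      ((centralizerBasis G).repr ⟨N i j, hN i j⟩ p : ℝ), ?_⟩
    have hNr : ∀ i j, realMat d (N i j) = ∑ p,
        ((centralizerBasis G).repr ⟨N i j, hN i j⟩ p : ℝ) •
          realMat d (centralizerBasis G p) := by
      intro i j
      have h := congrArg Subtype.val ((centralizerBasis G).sum_repr ⟨N i j, hN i j⟩)
      rw [Submodule.coe_sum] at h
      have h' := congrArg (realMat d) h
      rw [map_sum] at h'
      rw [← h']
      refine Finset.sum_congr rfl fun p _ => ?_
      rw [Submodule.coe_smul, map_zsmul, Int.cast_smul_eq_zsmul]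
    rw [hA]
    simp_rw [hNr, Finset.smul_sum, smul_smul, Finset.sum_smul]
    rw [Finset.sum_comm]
    refine Finset.sum_congr rfl fun i _ => ?_
    rw [Finset.sum_comm]
  have hα0 : α = 0 := by
    by_contra h
    refine hx (exists_mulVec_eq_zero_iff.1 ⟨α, h, ?_⟩)
    rw [← mulVec_mulVec, actionMat_mulVec, hα, hAx, mulVec_zero]
  have hA0 : A = 0 := by rw [← hα, hα0]; simp
  apply hv0
  ext k
  have hk := hAentry k k
  have hd : (d : ℝ) ^ 2 ≠ 0 := by
    have := k.pos
    positivity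
  rw [hA0, Matrix.zero_apply, eq_comm, mul_eq_zero, or_iff_right hd,
    Finset.sum_eq_zero_iff_of_nonneg fun σ _ => mul_self_nonneg _] at hk
  simpa using hk 1 (Finset.mem_univ _)

/-- Uniform version of `exists_dotProduct_pos` on balanced vectors. -/
theorem exists_uniform_dotProduct_ge (hG : IsTransitivePerm G) (C : ℝ) :
    ∃ c : ℝ, 0 < c ∧ ∀ x v : Fin d → ℝ, x ≠ 0 → v ≠ 0 → ∑ i, v i = 0 →
      (x ⬝ᵥ x) ^ Module.finrank ℤ (zeroSumCentralizer G) ≤ C * gramDet G x →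
      ∃ σ ∈ G, c * (√(x ⬝ᵥ x) * √(v ⬝ᵥ v)) ≤ (x ∘ σ) ⬝ᵥ v := by
  classical
  set K : Set ((Fin d → ℝ) × (Fin d → ℝ)) :=
    {p | p.1 ⬝ᵥ p.1 = 1 ∧ 1 ≤ C * gramDet G p.1 ∧ ∑ i, p.2 i = 0 ∧ p.2 ⬝ᵥ p.2 = 1} with hK
  have hbound : ∀ x : Fin d → ℝ, x ⬝ᵥ x = 1 → ‖x‖ ≤ 1 := by
    intro x hx
    refine (pi_norm_le_iff_of_nonneg zero_le_one).2 fun i => ?_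
    have h : x i * x i ≤ x ⬝ᵥ x :=
      Finset.single_le_sum (fun j _ => mul_self_nonneg (x j)) (Finset.mem_univ i)
    rw [Real.norm_eq_abs, ← sq_le_one_iff_abs_le_one]
    nlinarith
  have hKc : IsCompact K := by
    refine Metric.isCompact_of_isClosed_isBounded ?_ ?_
    · have h1 : Continuous fun p : (Fin d → ℝ) × (Fin d → ℝ) => C * gramDet G p.1 :=
        continuous_const.mul (continuous_gramDet.comp continuous_fst)
      have h2 : Continuous fun p : (Fin d → ℝ) × (Fin d → ℝ) => p.1 ⬝ᵥ p.1 := by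
        unfold dotProduct; fun_prop
      have h3 : Continuous fun p : (Fin d → ℝ) × (Fin d → ℝ) => p.2 ⬝ᵥ p.2 := by
        unfold dotProduct; fun_prop
      have h4 : Continuous fun p : (Fin d → ℝ) × (Fin d → ℝ) => ∑ i, p.2 i := by fun_prop
      exact (isClosed_eq h2 continuous_const).inter ((isClosed_le continuous_const h1).inter
        ((isClosed_eq h4 continuous_const).inter (isClosed_eq h3 continuous_const)))
    · refine (Metric.isBounded_closedBall (x := 0) (r := 1)).subset fun p hp => ?_
      rw [mem_closedBall_zero_iff, Prod.norm_def]
      exact max_le (hbound _ hp.1) (hbound _ hp.2.2.2)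
  let f : (Fin d → ℝ) × (Fin d → ℝ) → ℝ := fun p =>
    Finset.univ.sup' Finset.univ_nonempty fun σ : G => (p.1 ∘ (σ : Equiv.Perm (Fin d))) ⬝ᵥ p.2
  have hf : Continuous f := by
    refine Continuous.finset_sup'_apply _ fun σ _ => ?_
    unfold dotProduct
    simp only [Function.comp_apply]
    fun_prop
  obtain ⟨c, hc, hcK⟩ : ∃ c : ℝ, 0 < c ∧ ∀ p ∈ K, c ≤ f p := by
    rcases K.eq_empty_or_nonempty with h | h
    · exact ⟨1, one_pos, by simp [h]⟩
    obtain ⟨p, hp, hmin⟩ := hKc.exists_isMinOn h hf.continuousOn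
    refine ⟨f p, ?_, fun q hq => hmin hq⟩
    have hg : gramDet G p.1 ≠ 0 := fun h0 => by
      have := hp.2.1
      rw [h0, mul_zero] at this
      linarith
    have hp2 : p.2 ≠ 0 := fun h0 => by
      have := hp.2.2.2
      rw [h0] at this
      simp at this
    obtain ⟨σ, hσ, hpos⟩ := exists_dotProduct_pos hG hg hp.2.2.1 hp2
    exact (Finset.lt_sup'_iff _).2 ⟨⟨σ, hσ⟩, Finset.mem_univ _, hpos⟩
  refine ⟨c, hc, fun x v hx hv hvs hxC => ?_⟩
  have hpos : ∀ x : Fin d → ℝ, x ≠ 0 → 0 < √(x ⬝ᵥ x) := fun x hx =>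
    Real.sqrt_pos.2 ((dotProduct_self_nonneg_of_real x).lt_of_ne' (by simpa using hx))
  have hn : ∀ x : Fin d → ℝ, x ≠ 0 →
      ((√(x ⬝ᵥ x))⁻¹ • x) ⬝ᵥ ((√(x ⬝ᵥ x))⁻¹ • x) = 1 := by
    intro x hx
    rw [smul_dotProduct, dotProduct_smul, smul_eq_mul, smul_eq_mul]
    nth_rw 3 [← Real.mul_self_sqrt (dotProduct_self_nonneg_of_real x)]
    have := hpos x hx
    field_simp
  have hmem : ((√(x ⬝ᵥ x))⁻¹ • x, (√(v ⬝ᵥ v))⁻¹ • v) ∈ K := by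
    refine ⟨hn x hx, ?_, ?_, hn v hv⟩
    · have hq : 0 < x ⬝ᵥ x := Real.sqrt_pos.1 (hpos x hx)
      change 1 ≤ C * gramDet G ((√(x ⬝ᵥ x))⁻¹ • x)
      rw [gramDet_smul, inv_pow, Real.sq_sqrt hq.le, inv_pow, mul_left_comm,
        ← div_eq_inv_mul, one_le_div (by positivity)]
      exact hxC
    · simp [← Finset.mul_sum, hvs]
  obtain ⟨σ, -, hσ⟩ := (Finset.le_sup'_iff _).1 (hcK _ hmem)
  refine ⟨σ, σ.2, ?_⟩
  have h1 : ((√(x ⬝ᵥ x))⁻¹ • x) ∘ (σ : Equiv.Perm (Fin d)) =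
      (√(x ⬝ᵥ x))⁻¹ • (x ∘ (σ : Equiv.Perm (Fin d))) := rfl
  simp only [h1, smul_dotProduct, dotProduct_smul, smul_eq_mul] at hσ
  have hx' := hpos x hx
  have hv' := hpos v hv
  rwa [← mul_assoc, ← mul_inv, mul_comm √(v ⬝ᵥ v), ← div_eq_inv_mul,
    le_div_iff₀ (by positivity)] at hσ

theorem permOrbit_finite (G : Subgroup (Equiv.Perm (Fin d))) (w : Fin d → ℝ) :
    (permOrbit G w).Finite :=
  (Set.finite_range fun σ : Equiv.Perm (Fin d) => w ∘ σ).subset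
    (by rintro _ ⟨σ, -, rfl⟩; exact ⟨σ, rfl⟩)

theorem mem_convexHull_permOrbit {w p : Fin d → ℝ}
    (h : ∀ v : Fin d → ℝ, ∃ σ ∈ G, p ⬝ᵥ v ≤ (w ∘ σ) ⬝ᵥ v) :
    p ∈ convexHull ℝ (permOrbit G w) := by
  by_contra hp
  obtain ⟨f, u, hu, hpu⟩ := geometric_hahn_banach_closed_point (convex_convexHull ℝ _)
    ((permOrbit_finite G w).isClosed_convexHull ℝ) hp
  have hf : ∀ x, f x = x ⬝ᵥ fun i => f (Pi.single i 1) := by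
    intro x
    conv_lhs => rw [← Finset.univ_sum_single x]
    rw [map_sum, dotProduct]
    refine Finset.sum_congr rfl fun i _ => ?_
    have : Pi.single i (x i) = x i • (Pi.single i 1 : Fin d → ℝ) := by
      rw [← Pi.single_smul, smul_eq_mul, mul_one]
    rw [this, map_smul, smul_eq_mul]
  obtain ⟨σ, hσ, hle⟩ := h fun i => f (Pi.single i 1)
  rw [← hf, ← hf] at hle
  have := hu _ (subset_convexHull ℝ _ ⟨σ, hσ, rfl⟩)
  linarith

theorem centering_dotProduct_centering (p v : Fin d → ℝ) :
    (centering d ℝ *ᵥ p) ⬝ᵥ (centering d ℝ *ᵥ v) =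
      d * (d * (p ⬝ᵥ v) - (∑ i, p i) * ∑ i, v i) := by
  rw [dotProduct_comm, dotProduct_mulVec, ← mulVec_transpose, centering_transpose,
    centering_mulVec_of_sum_eq_zero (sum_centering_mulVec v), smul_dotProduct, smul_eq_mul]
  congr 1
  simp only [dotProduct, centering_mulVec, sub_mul, Finset.sum_sub_distrib, Finset.mul_sum,
    Finset.sum_mul]
  congr 1
  · exact Finset.sum_congr rfl fun i _ => by ring
  · rw [Finset.sum_comm]
    exact Finset.sum_congr rfl fun i _ => Finset.sum_congr rfl fun j _ => by ring

theorem dotProduct_le_sqrt_mul_sqrt (p v : Fin d → ℝ) :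
    p ⬝ᵥ v ≤ √(p ⬝ᵥ p) * √(v ⬝ᵥ v) := by
  have h := Real.sum_mul_le_sqrt_mul_sqrt Finset.univ p v
  simpa [dotProduct, sq] using h

/-- The orbit polytope of a balanced point contains every nearby point in its affine hull. -/
theorem exists_mem_convexHull_of_balanced (hG : IsTransitivePerm G) (C : ℝ) :
    ∃ c : ℝ, 0 < c ∧ ∀ w p : Fin d → ℝ, centering d ℝ *ᵥ w ≠ 0 →
      let x := centering d ℝ *ᵥ w
      (x ⬝ᵥ x) ^ Module.finrank ℤ (zeroSumCentralizer G) ≤ C * gramDet G x →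
      ∑ i, p i = ∑ i, w i →
      (centering d ℝ *ᵥ p) ⬝ᵥ (centering d ℝ *ᵥ p) ≤ c ^ 2 * (x ⬝ᵥ x) →
      p ∈ convexHull ℝ (permOrbit G w) := by
  obtain ⟨c, hc, hcx⟩ := exists_uniform_dotProduct_ge hG C
  refine ⟨c, hc, ?_⟩
  intro w p hw x hx hpw hp
  refine mem_convexHull_permOrbit fun v => ?_
  have hd : (0 : ℝ) < d := by
    rcases Nat.eq_zero_or_pos d with rfl | h
    · exact (hw (Subsingleton.elim _ _)).elim
    · exact_mod_cast h
  obtain ⟨σ, hσ, hle⟩ : ∃ σ ∈ G, (centering d ℝ *ᵥ p) ⬝ᵥ (centering d ℝ *ᵥ v) ≤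
      (x ∘ σ) ⬝ᵥ (centering d ℝ *ᵥ v) := by
    by_cases hv : centering d ℝ *ᵥ v = 0
    · exact ⟨1, one_mem _, by simp [hv]⟩
    obtain ⟨σ, hσ, h⟩ := hcx x _ hw hv (sum_centering_mulVec v) hx
    refine ⟨σ, hσ, (dotProduct_le_sqrt_mul_sqrt _ _).trans (le_trans ?_ h)⟩
    rw [← mul_assoc]
    gcongr
    rw [Real.sqrt_le_left (by positivity), mul_pow, Real.sq_sqrt (dotProduct_self_nonneg_of_real x)]
    exact hp
  refine ⟨σ, hσ, ?_⟩
  have hsum : ∑ i, (w ∘ σ) i = ∑ i, w i := Equiv.sum_comp σ w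
  rw [← centering_mulVec_comp, centering_dotProduct_centering, centering_dotProduct_centering,
    hpw, hsum] at hle
  have h1 := le_of_mul_le_mul_left hle hd
  exact le_of_mul_le_mul_left (by linarith) hd

theorem IsCorePoint.affine_image {z b : Fin d → ℝ} (hz : IsCorePoint G z)
    (S : (Fin d → ℝ) ≃ₗ[ℝ] (Fin d → ℝ)) (hS : ⇑S '' intVecs d = intVecs d)
    (hSG : ∀ σ ∈ G, ∀ x : Fin d → ℝ, S (x ∘ ⇑σ) = (S x) ∘ ⇑σ)
    (hb : b ∈ intVecs d) (hbG : ∀ σ ∈ G, b ∘ ⇑σ = b) : IsCorePoint G (S z + b) := by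
  let φ : (Fin d → ℝ) →ᵃ[ℝ] (Fin d → ℝ) := S.toLinearMap.toAffineMap + AffineMap.const ℝ _ b
  have hφ : ∀ x, φ x = S x + b := fun x => rfl
  have hinj : Function.Injective φ := fun x y h => S.injective (add_right_cancel h)
  have hint : φ '' intVecs d = intVecs d := by
    have h1 : φ '' intVecs d = (fun x => x + b) '' (S '' intVecs d) := by
      rw [Set.image_image]
      rfl
    rw [h1, hS]
    ext x
    constructor
    · rintro ⟨y, hy, rfl⟩ i
      obtain ⟨m, hm⟩ := hy i
      obtain ⟨n, hn⟩ := hb i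
      exact ⟨m + n, by simp [hm, hn]⟩
    · intro hx
      refine ⟨x - b, fun i => ?_, sub_add_cancel x b⟩
      obtain ⟨m, hm⟩ := hx i
      obtain ⟨n, hn⟩ := hb i
      exact ⟨m - n, by simp [hm, hn]⟩
  have horb : permOrbit G (S z + b) = φ '' permOrbit G z := by
    have h1 : ∀ σ ∈ G, (S z + b) ∘ ⇑σ = φ (z ∘ σ) := by
      intro σ hσ
      rw [hφ, hSG σ hσ]
      conv_rhs => rw [← hbG σ hσ]
      rfl
    ext x
    constructor
    · rintro ⟨σ, hσ, rfl⟩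
      exact ⟨_, ⟨σ, hσ, rfl⟩, (h1 σ hσ).symm⟩
    · rintro ⟨_, ⟨σ, hσ, rfl⟩, rfl⟩
      exact ⟨σ, hσ, (h1 σ hσ).symm⟩
  refine ⟨?_, ?_⟩
  · rw [← hint]
    exact ⟨z, hz.1, rfl⟩
  · rw [horb, ← AffineMap.image_convexHull]
    conv_lhs => rw [← hint]
    rw [← Set.image_inter hinj, hz.2]

/-- A unit of the integral centralizer ring as a linear automorphism of `ℝ^d`. -/
noncomputable def unitEquiv (u u' : Matrix (Fin d) (Fin d) ℤ) (h : u * u' = 1) (h' : u' * u = 1) :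
    (Fin d → ℝ) ≃ₗ[ℝ] (Fin d → ℝ) :=
  Matrix.toLin'OfInv (M := realMat d u') (M' := realMat d u)
    (by rw [← map_mul, h', map_one]) (by rw [← map_mul, h, map_one])

theorem unitEquiv_apply {u u' : Matrix (Fin d) (Fin d) ℤ} (h : u * u' = 1) (h' : u' * u = 1)
    (x : Fin d → ℝ) : unitEquiv u u' h h' x = realMat d u *ᵥ x := rfl

theorem mem_intVecs_iff {x : Fin d → ℝ} :
    x ∈ intVecs d ↔ ∃ n : Fin d → ℤ, (fun i => (n i : ℝ)) = x :=
  ⟨fun h => ⟨fun i => (h i).choose, funext fun i => (h i).choose_spec.symm⟩,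
    by rintro ⟨n, rfl⟩ i; exact ⟨n i, rfl⟩⟩

theorem unitEquiv_image_intVecs {u u' : Matrix (Fin d) (Fin d) ℤ} (h : u * u' = 1)
    (h' : u' * u = 1) : unitEquiv u u' h h' '' intVecs d = intVecs d := by
  have hmem : ∀ (A : Matrix (Fin d) (Fin d) ℤ) x, x ∈ intVecs d → realMat d A *ᵥ x ∈ intVecs d := by
    intro A x hx
    obtain ⟨n, rfl⟩ := mem_intVecs_iff.1 hx
    rw [realMat_mulVec_cast]
    exact fun i => ⟨_, rfl⟩
  ext x
  constructor
  · rintro ⟨y, hy, rfl⟩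
    rw [unitEquiv_apply]
    exact hmem u y hy
  · intro hx
    refine ⟨realMat d u' *ᵥ x, hmem u' x hx, ?_⟩
    rw [unitEquiv_apply, mulVec_mulVec, ← map_mul, h, map_one, one_mulVec]

theorem unitEquiv_comp {u u' : Matrix (Fin d) (Fin d) ℤ} (h : u * u' = 1) (h' : u' * u = 1)
    (hu : u - 1 ∈ zeroSumCentralizer G) {σ : Equiv.Perm (Fin d)} (hσ : σ ∈ G) (x : Fin d → ℝ) :
    unitEquiv u u' h h' (x ∘ σ) = unitEquiv u u' h h' x ∘ σ := by
  have h1 := mulVec_comp_of_submatrix_eq (realMat_submatrix hu hσ) x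
  rw [map_sub, map_one, sub_mulVec, sub_mulVec, one_mulVec, one_mulVec] at h1
  rw [unitEquiv_apply, unitEquiv_apply]
  ext i
  simpa using congrFun h1 i

theorem IsCorePoint.normEquiv_translate {z : Fin d → ℝ} {S : (Fin d → ℝ) ≃ₗ[ℝ] (Fin d → ℝ)}
    (hz : IsCorePoint G z)
    (hS : ⇑S '' intVecs d = intVecs d)
    (hSG : ∀ σ ∈ G, ∀ x : Fin d → ℝ, S (x ∘ ⇑σ) = (S x) ∘ ⇑σ) (q : ℤ) :
    NormEquiv G z (S z - fun _ => (q : ℝ)) ∧ IsCorePoint G (S z - fun _ => (q : ℝ)) := by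
  have hb : (-fun _ => (q : ℝ)) ∈ intVecs d := fun i => ⟨-q, by simp⟩
  rw [sub_eq_add_neg]
  exact ⟨⟨S, _, hS, fun σ hσ => ⟨σ, hσ, hSG σ hσ⟩, hb, fun σ _ => rfl, rfl⟩,
    hz.affine_image S hS hSG hb fun σ _ => rfl⟩

theorem exists_bounded_isCorePoint (hQI : IsQIGroup G) :
    ∃ M : ℝ, ∀ z, IsCorePoint G z →
      ∃ w, NormEquiv G z w ∧ IsCorePoint G w ∧ ∑ i, (w i) ^ 2 ≤ M := by
  rcases Nat.eq_zero_or_pos d with rfl | hd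
  · refine ⟨0, fun z hz => ?_⟩
    obtain ⟨h1, h2⟩ := hz.normEquiv_translate (S := LinearEquiv.refl ℝ _) (Set.image_id _)
      (fun _ _ _ => rfl) 0
    exact ⟨_, h1, h2, by simp⟩
  have hdR : (0 : ℝ) < d := by exact_mod_cast hd
  have hdZ : (0 : ℤ) < d := by exact_mod_cast hd
  obtain ⟨C, hC0, hC⟩ := exists_balancing_unit hQI
  obtain ⟨c, hc, hball⟩ := exists_mem_convexHull_of_balanced hQI.1 C
  set δ : Fin d → ℝ := Pi.single ⟨0, hd⟩ 1 with hδ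
  set D : ℝ := (d : ℝ) ^ 2 * ((centering d ℝ *ᵥ δ) ⬝ᵥ (centering d ℝ *ᵥ δ)) with hD
  have hD0 : 0 ≤ D := mul_nonneg (by positivity) (dotProduct_self_nonneg_of_real _)
  -- the zero-sum part determines the norm up to translation by fixed vectors
  have hbound : ∀ w : Fin d → ℝ, w ∈ intVecs d → ∃ q : ℤ, ∑ i, (w i - q) ^ 2 ≤
      2 * ((centering d ℝ *ᵥ w) ⬝ᵥ (centering d ℝ *ᵥ w)) + 2 * d ^ 3 ∧
      ∃ p ∈ intVecs d, ∑ i, p i = ∑ i, w i ∧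
        (centering d ℝ *ᵥ p) ⬝ᵥ (centering d ℝ *ᵥ p) ≤ D := by
    intro w hw
    obtain ⟨n, rfl⟩ := mem_intVecs_iff.1 hw
    set N : ℤ := ∑ i, n i with hN
    set ρ : ℤ := N % d with hρ
    have hρ0 : (0 : ℝ) ≤ ρ := by exact_mod_cast Int.emod_nonneg N hdZ.ne'
    have hρd : (ρ : ℝ) ≤ d := by exact_mod_cast (Int.emod_lt_of_pos N hdZ).le
    have hNdiv : (N : ℝ) = d * (N / d : ℤ) + ρ := by
      exact_mod_cast (Int.mul_ediv_add_emod N d).symm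
    have hNsum : ∑ i, (n i : ℝ) = N := by simp [hN]
    refine ⟨N / d, ?_, (fun _ => ((N / d : ℤ) : ℝ)) + (ρ : ℝ) • δ, fun i => ?_, ?_, ?_⟩
    · have h1 : ∀ i, ((n i : ℝ) - (N / d : ℤ)) ^ 2 ≤
          2 * ((centering d ℝ *ᵥ fun i => (n i : ℝ)) i * (centering d ℝ *ᵥ fun i => (n i : ℝ)) i)
            + 2 * d ^ 2 := by
        intro i
        rw [centering_mulVec, hNsum]
        have h2 : (d : ℝ) * (n i - (N / d : ℤ)) = (d * n i - N) + ρ := by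
          rw [hNdiv]
          ring
        have h3 : (1 : ℝ) ≤ d := by exact_mod_cast hd
        have h4 : ((n i : ℝ) - (N / d : ℤ)) ^ 2 ≤ ((d : ℝ) * (n i - (N / d : ℤ))) ^ 2 := by
          rw [mul_pow]
          exact le_mul_of_one_le_left (sq_nonneg _) (one_le_pow₀ h3)
        rw [h2] at h4
        nlinarith [sq_nonneg ((d * n i - N : ℝ) - ρ), mul_le_mul hρd hρd hρ0 hdR.le]
      calc _ ≤ ∑ i, (2 * ((centering d ℝ *ᵥ fun i => (n i : ℝ)) i *
            (centering d ℝ *ᵥ fun i => (n i : ℝ)) i) + 2 * (d : ℝ) ^ 2) :=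
            Finset.sum_le_sum fun i _ => h1 i
        _ = _ := by
            rw [Finset.sum_add_distrib, ← Finset.mul_sum, dotProduct]
            simp
            ring
    · by_cases hi : i = ⟨0, hd⟩
      · exact ⟨N / d + ρ, by subst hi; simp [hδ]⟩
      · exact ⟨N / d, by simp [hδ, hi]⟩
    · simp only [Pi.add_apply, Pi.smul_apply, smul_eq_mul, Finset.sum_add_distrib,
        ← Finset.mul_sum, hδ, Finset.sum_pi_single', Finset.sum_const, hNsum, hNdiv]
      simp
    · have h1 : centering d ℝ *ᵥ ((fun _ => ((N / d : ℤ) : ℝ)) + (ρ : ℝ) • δ) =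
          (ρ : ℝ) • (centering d ℝ *ᵥ δ) := by
        rw [mulVec_add, mulVec_smul, add_eq_right]
        ext i
        simp [centering_mulVec]
      rw [h1, smul_dotProduct, dotProduct_smul, smul_eq_mul, smul_eq_mul, ← mul_assoc, hD, sq]
      have := dotProduct_self_nonneg_of_real (centering d ℝ *ᵥ δ)
      gcongr
  refine ⟨2 * (D + D / c ^ 2) + 2 * d ^ 3, fun z hz => ?_⟩
  obtain ⟨n, rfl⟩ := mem_intVecs_iff.1 hz.1
  set y : Fin d → ℤ := centering d ℤ *ᵥ n with hy
  obtain ⟨S, hS, hSG, hSq⟩ : ∃ S : (Fin d → ℝ) ≃ₗ[ℝ] (Fin d → ℝ), ⇑S '' intVecs d = intVecs d ∧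
      (∀ σ ∈ G, ∀ x : Fin d → ℝ, S (x ∘ ⇑σ) = (S x) ∘ ⇑σ) ∧
      (centering d ℝ *ᵥ S fun i => (n i : ℝ)) ⬝ᵥ (centering d ℝ *ᵥ S fun i => (n i : ℝ)) ≤
        D + D / c ^ 2 := by
    have hDc : 0 ≤ D / c ^ 2 := by positivity
    by_cases hy0 : y = 0
    · refine ⟨LinearEquiv.refl ℝ _, Set.image_id _, fun _ _ _ => rfl, ?_⟩
      have h1 := realMat_mulVec_cast (centering d ℤ) n
      rw [realMat_centering, ← hy, hy0] at h1
      rw [LinearEquiv.refl_apply, h1]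
      simpa [dotProduct] using add_nonneg hD0 hDc
    · obtain ⟨u, u', hu, huu', hu'u, hx⟩ := hC y (sum_centering_mulVec n) hy0
      have hSint := unitEquiv_image_intVecs huu' hu'u
      have hSG : ∀ σ ∈ G, ∀ x : Fin d → ℝ, unitEquiv u u' huu' hu'u (x ∘ ⇑σ) =
        (unitEquiv u u' huu' hu'u x) ∘ ⇑σ := fun σ hσ x => unitEquiv_comp huu' hu'u hu hσ x
      refine ⟨unitEquiv u u' huu' hu'u, hSint, hSG, ?_⟩
      set w : Fin d → ℝ := unitEquiv u u' huu' hu'u fun i => (n i : ℝ) with hw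
      have hcomm : u * centering d ℤ = centering d ℤ * u := by
        have h1 := (mul_centering hu).trans (centering_mul hu).symm
        rw [sub_mul, mul_sub, one_mul, mul_one] at h1
        exact sub_left_injective h1
      have hxw : realMat d u *ᵥ (fun i => (y i : ℝ)) = centering d ℝ *ᵥ w := by
        rw [hw, unitEquiv_apply, hy, ← realMat_mulVec_cast, mulVec_mulVec, ← map_mul, hcomm,
          map_mul, ← mulVec_mulVec, realMat_centering]
      rw [hxw] at hx
      have hw0 : centering d ℝ *ᵥ w ≠ 0 := by
        intro h0
        have h1 : unitEquiv u u' huu' hu'u (fun i => (y i : ℝ)) = 0 := by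
          rw [unitEquiv_apply, hxw, h0]
        rw [LinearEquiv.map_eq_zero_iff] at h1
        apply hy0
        ext i
        simpa using congrFun h1 i
      have hcore : IsCorePoint G w := by
        have h1 := hz.affine_image (b := 0) _ hSint hSG (fun i => ⟨0, by simp⟩) fun σ _ => rfl
        rwa [add_zero] at h1
      obtain ⟨-, -, p, hp, hpw, hpD⟩ := hbound w hcore.1
      by_cases hle : (centering d ℝ *ᵥ p) ⬝ᵥ (centering d ℝ *ᵥ p) ≤
          c ^ 2 * ((centering d ℝ *ᵥ w) ⬝ᵥ (centering d ℝ *ᵥ w))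
      · have hpmem : p ∈ permOrbit G w := by
          rw [← hcore.2]
          exact ⟨hball w p hw0 hx hpw hle, hp⟩
        obtain ⟨σ, -, rfl⟩ := hpmem
        rw [centering_mulVec_comp, comp_equiv_dotProduct_comp_equiv] at hpD
        exact hpD.trans (le_add_of_nonneg_right hDc)
      · have h1 : (centering d ℝ *ᵥ w) ⬝ᵥ (centering d ℝ *ᵥ w) ≤ D / c ^ 2 := by
          rw [le_div_iff₀ (by positivity), mul_comm]
          exact (not_le.1 hle).le.trans hpD
        exact h1.trans (le_add_of_nonneg_left hD0)
  have hSz : S (fun i => (n i : ℝ)) ∈ intVecs d := by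
    rw [← hS]
    exact ⟨_, hz.1, rfl⟩
  obtain ⟨q, hq, -⟩ := hbound _ hSz
  obtain ⟨h1, h2⟩ := hz.normEquiv_translate hS hSG q
  refine ⟨_, h1, h2, ?_⟩
  simp only [Pi.sub_apply]
  linarith

theorem finite_intVecs_sum_sq_le (d : ℕ) (M : ℝ) :
    {w : Fin d → ℝ | w ∈ intVecs d ∧ ∑ i, (w i) ^ 2 ≤ M}.Finite := by
  refine ((Set.finite_Icc (fun _ : Fin d => -⌈M⌉) (fun _ => ⌈M⌉)).image
    fun n i => (n i : ℝ)).subset ?_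
  rintro w ⟨hw, hM⟩
  obtain ⟨n, rfl⟩ := mem_intVecs_iff.1 hw
  have h : ∀ i, |n i| ≤ ⌈M⌉ := by
    intro i
    have h1 : (n i : ℝ) ^ 2 ≤ M :=
      (Finset.single_le_sum (f := fun i => (n i : ℝ) ^ 2) (fun j _ => sq_nonneg _)
        (Finset.mem_univ i)).trans hM
    have h2 : n i ^ 2 ≤ ⌈M⌉ := by exact_mod_cast h1.trans (Int.le_ceil M)
    rw [Int.abs_eq_natAbs]
    exact (Int.natAbs_le_self_sq _).trans h2
  exact ⟨n, ⟨fun i => (abs_le.1 (h i)).1, fun i => (abs_le.1 (h i)).2⟩, rfl⟩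

/-- For a QI-group `G ≤ S_d` there is a constant `M` depending only on `G`
such that every core point is normalizer equivalent to a core point `w` with `‖w‖² ≤ M`;
in particular there are only finitely many core points up to normalizer equivalence. -/
theorem stmt_18 {d : ℕ} (G : Subgroup (Equiv.Perm (Fin d))) (hQI : IsQIGroup G) :
    (∃ M : ℝ, ∀ z, IsCorePoint G z →
      ∃ w, NormEquiv G z w ∧ IsCorePoint G w ∧ ∑ i, (w i) ^ 2 ≤ M) ∧
    ∃ T : Set (Fin d → ℝ), T.Finite ∧
      ∀ z, IsCorePoint G z → ∃ w ∈ T, NormEquiv G z w := by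
  obtain ⟨M, hM⟩ := exists_bounded_isCorePoint hQI
  refine ⟨⟨M, hM⟩, _, finite_intVecs_sum_sq_le d M, fun z hz => ?_⟩
  obtain ⟨w, hzw, hw, hwM⟩ := hM z hz
  exact ⟨w, ⟨hw.1, hwM⟩, hzw⟩
end
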